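/- arXiv:2007.14161 — 11 statements merged into one kernel-verified Lean document; each statement's English description precedes it below -/
import Mathlib

section
/- Let G be a finite simple graph on n vertices with maximum degree at most d, and let k be a positive integer. Then the number of vertex subsets of G of size at most k that induce a connected subgraph of G is at most (d^(2k-2) + 1)·n. -/
/-- Pushing a walk of an induced subgraph to the ambient graph. -/
theorem aux_push {V : Type*} (G : SimpleGraph V) (S : Set V) {u v : S}
    (p : (G.induce S).Walk u v) : ∃ q : G.Walk (u : V) (v : V),
      q.length = p.length ∧ ∀ w, w ∈ q.support ↔ ∃ h : w ∈ S, (⟨w, h⟩ : S) ∈ p.support := by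
  refine ⟨p.map (SimpleGraph.Embedding.induce S).toHom, SimpleGraph.Walk.length_map _ _, ?_⟩
  intro w
  have := SimpleGraph.Walk.support_map (SimpleGraph.Embedding.induce (G := G) S).toHom p
  refine Iff.trans (iff_of_eq (congrArg (w ∈ ·) this)) ?_
  rw [List.mem_map]
  constructor
  · rintro ⟨a, ha, rfl⟩; exact ⟨a.2, ha⟩
  · rintro ⟨h, hw⟩; exact ⟨_, hw, rfl⟩

/-- A connected graph on `m + 1` vertices has a spanning closed walk of length `2 * m`. -/
theorem aux_closed_walk (m : ℕ) : ∀ {W : Type*} [Finite W] (H : SimpleGraph W),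
    H.Connected → Nat.card W = m + 1 →
    ∃ (v : W) (p : H.Walk v v), p.length = 2 * m ∧ ∀ w, w ∈ p.support := by
  induction m with
  | zero =>
    intro W _ H hH hc
    obtain ⟨v⟩ := hH.nonempty
    have : Subsingleton W := (Nat.card_eq_one_iff_unique.mp hc).1
    exact ⟨v, .nil, by simp, fun w => by simp [Subsingleton.elim w v]⟩
  | succ m ih =>
    intro W _ H hH hc
    classical
    have hnt : Nontrivial W := Finite.one_lt_card_iff_nontrivial.mp (by omega)
    obtain ⟨x, hx⟩ := hH.exists_connected_induce_compl_singleton_of_finite_nontrivial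
    have hcard : Nat.card ({x}ᶜ : Set W) = m + 1 := by
      have h1 := Set.ncard_add_ncard_compl ({x} : Set W)
      rw [Set.ncard_singleton, hc] at h1
      rw [Nat.card_coe_set_eq]; omega
    obtain ⟨v, p, hp, hs⟩ := ih (H.induce {x}ᶜ) hx hcard
    obtain ⟨y, hy⟩ := hH.preconnected.exists_adj_of_nontrivial x
    obtain ⟨q, hql, hqs⟩ := aux_push H _ p
    have hq : ∀ w, w ≠ x → w ∈ q.support := fun w hw => (hqs w).mpr ⟨hw, hs _⟩
    have hyq : y ∈ q.support := hq y hy.ne'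
    refine ⟨y, .cons hy.symm (.cons hy (q.rotate y hyq)), ?_, ?_⟩
    · simp [hql, hp]; ring
    · intro w
      by_cases hw : w = x
      · simp [hw]
      · simp only [SimpleGraph.Walk.support_cons, List.mem_cons]
        right; right
        rw [SimpleGraph.Walk.mem_support_rotate_iff]
        exact hq w hw

/-- Padding a nonempty closed walk by back-and-forth steps. -/
theorem aux_pad {V : Type*} (G : SimpleGraph V) (j : ℕ) : ∀ {v : V} (p : G.Walk v v),
    p.length ≠ 0 → ∃ q : G.Walk v v, q.length = p.length + 2 * j ∧
      {w | w ∈ q.support} = {w | w ∈ p.support} := by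
  intro v p hp
  cases p with
  | nil => simp at hp
  | cons h p =>
    induction j with
    | zero => exact ⟨.cons h p, by simp, rfl⟩
    | succ j ih =>
      obtain ⟨q, hq, hs⟩ := ih
      refine ⟨.cons h (.cons h.symm q), by simp [hq]; ring, ?_⟩
      rw [← hs]
      have hu : ∀ w, w = _ → w ∈ q.support := fun w hw => by
        have : w ∈ {w | w ∈ (SimpleGraph.Walk.cons h p).support} := by
          rw [hw]; simp only [Set.mem_ofPred_eq, SimpleGraph.Walk.support_cons]
          exact List.mem_cons_of_mem _ p.start_mem_support
        rw [← hs] at this; exact this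
      ext w
      simp only [SimpleGraph.Walk.support_cons, List.mem_cons, Set.mem_ofPred_eq]
      constructor
      · rintro (rfl | hw | hw)
        · exact q.start_mem_support
        · exact hu _ hw
        · exact hw
      · exact fun hw => Or.inr (Or.inr hw)

open Classical in
/-- Vertex sets of walks of length `n` starting at `v`. -/
noncomputable def auxSets {V : Type*} [Fintype V] (G : SimpleGraph V) [DecidableRel G.Adj] :
    ℕ → V → Finset (Set V)
  | 0, v => {{v}}
  | n + 1, v => (G.neighborFinset v).biUnion fun w => (auxSets G n w).image (insert v)

theorem auxSets_card {V : Type*} [Fintype V] (G : SimpleGraph V) [DecidableRel G.Adj]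
    (d : ℕ) (hdeg : ∀ v : V, G.degree v ≤ d) (n : ℕ) : ∀ v, (auxSets G n v).card ≤ d ^ n := by
  classical
  induction n with
  | zero => intro v; simp [auxSets]
  | succ n ih =>
    intro v
    rw [auxSets, pow_succ']
    refine (Finset.card_biUnion_le_card_mul _ _ (d ^ n)
      fun w _ => Finset.card_image_le.trans (ih w)).trans ?_
    exact Nat.mul_le_mul_right _ (hdeg v)

theorem auxSets_mem {V : Type*} [Fintype V] (G : SimpleGraph V) [DecidableRel G.Adj]
    {u v : V} (p : G.Walk u v) : {w | w ∈ p.support} ∈ auxSets G p.length u := by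
  classical
  induction p with
  | nil => simp [auxSets]
  | cons h p ih =>
    simp only [SimpleGraph.Walk.length_cons, auxSets, Finset.mem_biUnion, Finset.mem_image]
    refine ⟨_, by simpa using h, _, ih, ?_⟩
    ext w; simp

/-- The number of vertex subsets of size at most `k` inducing a connected subgraph in
an `n`-vertex graph of maximum degree at most `d` is at most `(d ^ (2 * k - 2) + 1) * n`. -/
theorem stmt_0 {V : Type*} [Fintype V] (G : SimpleGraph V) [DecidableRel G.Adj]
    (d k : ℕ) (hk : 1 ≤ k) (hdeg : ∀ v : V, G.degree v ≤ d) :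
    {S : Set V | S.ncard ≤ k ∧ (G.induce S).Connected}.ncard ≤
      (d ^ (2 * k - 2) + 1) * Fintype.card V := by
  classical
  let A : Finset (Set V) := Finset.univ.biUnion fun v => auxSets G (2 * k - 2) v
  let B : Finset (Set V) := Finset.univ.image fun v => {v}
  have hA : A.card ≤ Fintype.card V * d ^ (2 * k - 2) :=
    Finset.card_biUnion_le_card_mul _ _ _ fun v _ => auxSets_card G d hdeg _ v
  have hB : B.card ≤ Fintype.card V := Finset.card_image_le
  have hsub : {S : Set V | S.ncard ≤ k ∧ (G.induce S).Connected} ⊆ ((A ∪ B : Finset _) : Set _) := by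
    rintro S ⟨hSk, hS⟩
    obtain ⟨⟨x, hx⟩⟩ := hS.nonempty
    have hpos : 0 < S.ncard := (Set.ncard_pos S.toFinite).mpr ⟨x, hx⟩
    obtain ⟨m, hm⟩ : ∃ m, S.ncard = m + 1 := ⟨S.ncard - 1, by omega⟩
    rw [Finset.coe_union]
    by_cases h0 : m = 0
    · right
      obtain ⟨a, ha⟩ := Set.ncard_eq_one.mp (by omega : S.ncard = 1)
      simp [B, ha]
    · left
      obtain ⟨v, p, hp, hs⟩ := aux_closed_walk m (G.induce S) hS (by rw [Nat.card_coe_set_eq, hm])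
      obtain ⟨q, hql, hqs⟩ := aux_push G _ p
      have hq : {w | w ∈ q.support} = S := by
        ext w
        exact (hqs w).trans ⟨fun ⟨h, _⟩ => h, fun h => ⟨h, hs _⟩⟩
      obtain ⟨r, hr, hrs⟩ := aux_pad G (k - 1 - m) q (by omega)
      have := auxSets_mem G r
      rw [hrs, hq, show r.length = 2 * k - 2 by omega] at this
      simp only [A, Finset.coe_biUnion, Set.mem_iUnion]
      exact ⟨v, by simp, this⟩
  calc _ ≤ ((A ∪ B : Finset _) : Set (Set V)).ncard := Set.ncard_le_ncard hsub (Finset.finite_toSet _)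
    _ = (A ∪ B).card := Set.ncard_coe_finset _
    _ ≤ A.card + B.card := Finset.card_union_le _ _
    _ ≤ _ := by rw [add_mul, one_mul, mul_comm (d ^ _)]; omega
end

section
/- Let G be a finite simple graph with maximum degree at most d, let X be a set of vertices of G, and let k be a positive integer. Then the number of connected vertex subsets of G of size at most k that intersect X is at most (d^(2k-2) + 1)·|X|. -/
open Classical in
/-- Vertex sets of walks of length `n` starting at `x`. -/
noncomputable def walkSets {V : Type*} [Fintype V] (G : SimpleGraph V) [DecidableRel G.Adj] :
    ℕ → V → Finset (Set V)
  | 0, x => {{x}}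
  | n + 1, x => (G.neighborFinset x).biUnion fun y => (walkSets G n y).image (insert x)

theorem walkSets_card {V : Type*} [Fintype V] (G : SimpleGraph V) [DecidableRel G.Adj]
    (d : ℕ) (hdeg : ∀ v : V, G.degree v ≤ d) (n : ℕ) (x : V) :
    (walkSets G n x).card ≤ d ^ n := by
  classical
  induction n generalizing x with
  | zero => simp [walkSets]
  | succ n ih =>
    rw [walkSets, pow_succ']
    refine (Finset.card_biUnion_le_card_mul _ _ (d ^ n) ?_).trans
      (Nat.mul_le_mul_right _ (by simpa using hdeg x))
    intro y _
    exact Finset.card_image_le.trans (ih y)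

theorem support_mem_walkSets {V : Type*} [Fintype V] (G : SimpleGraph V) [DecidableRel G.Adj]
    {x y : V} (w : G.Walk x y) : {v | v ∈ w.support} ∈ walkSets G w.length x := by
  classical
  induction w with
  | nil => simp [walkSets]
  | cons h p ih =>
    simp only [SimpleGraph.Walk.length_cons, walkSets, Finset.mem_biUnion, Finset.mem_image,
      SimpleGraph.mem_neighborFinset]
    refine ⟨_, h, _, ih, ?_⟩
    ext v
    simp

theorem extend_walk {V : Type*} (G : SimpleGraph V) {x : V} (w : G.Walk x x) (hw : 0 < w.length)
    (t : ℕ) : ∃ w' : G.Walk x x, w'.length = w.length + 2 * t ∧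
      ∀ v, v ∈ w'.support ↔ v ∈ w.support := by
  induction t with
  | zero => exact ⟨w, by simp, by simp⟩
  | succ t ih =>
    obtain ⟨w', hl, hs⟩ := ih
    cases w' with
    | nil => simp at hl; omega
    | cons h p =>
      refine ⟨.cons h (.cons h.symm (.cons h p)), ?_, ?_⟩
      · simp at hl ⊢; omega
      · intro v
        rw [← hs]
        have := p.start_mem_support
        simp only [SimpleGraph.Walk.support_cons, List.mem_cons]
        grind

theorem grow_walk {V : Type*} [Fintype V] (G : SimpleGraph V) (S : Set V)
    (hS : (G.induce S).Connected) {x : V} (hx : x ∈ S) (j : ℕ) (hj : j < S.ncard) :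
    ∃ w : G.Walk x x, w.length = 2 * j ∧ {v | v ∈ w.support} ⊆ S ∧
      {v | v ∈ w.support}.ncard = j + 1 := by
  classical
  induction j with
  | zero => exact ⟨.nil, by simp [hx]⟩
  | succ j ih =>
    obtain ⟨w, hl, hs, hc⟩ := ih (by omega)
    have : ∃ z ∈ S, z ∉ w.support := by
      by_contra! hcon
      have := Set.ncard_le_ncard (s := S) (t := {v | v ∈ w.support}) hcon
      omega
    obtain ⟨z, hz, hzw⟩ := this
    obtain ⟨p⟩ := hS.preconnected ⟨x, hx⟩ ⟨z, hz⟩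
    obtain ⟨e, -, h1, h2⟩ := p.exists_boundary_dart {v | (v : V) ∈ w.support}
      (by simp) (by simpa using hzw)
    have hadj : G.Adj e.fst.1 e.snd.1 := e.adj
    have hb := e.snd.2
    have h1' : e.fst.1 ∈ w.support := h1
    have h2' : e.snd.1 ∉ w.support := h2
    have key : ∃ w' : G.Walk x x, w'.length = w.length + 2 ∧
        {v | v ∈ w'.support} = insert e.snd.1 {v | v ∈ w.support} := by
      refine ⟨(w.takeUntil _ h1').append
        (.cons hadj (.cons hadj.symm (w.dropUntil _ h1'))), ?_, ?_⟩
      · have := congrArg SimpleGraph.Walk.length (w.take_spec h1')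
        simp only [SimpleGraph.Walk.length_append, SimpleGraph.Walk.length_cons] at this ⊢
        omega
      · ext v
        have h3 : v ∈ w.support ↔ v ∈ (w.takeUntil _ h1').support ∨
            v ∈ (w.dropUntil _ h1').support := by
          rw [← SimpleGraph.Walk.mem_support_append_iff, w.take_spec h1']
        have h4 := (w.dropUntil _ h1').start_mem_support
        simp only [Set.mem_ofPred_eq, Set.mem_insert_iff, h3,
          SimpleGraph.Walk.mem_support_append_iff, SimpleGraph.Walk.support_cons, List.mem_cons]
        grind
    obtain ⟨w', hl', hs'⟩ := key
    refine ⟨w', by omega, ?_, ?_⟩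
    · rw [hs']
      exact Set.insert_subset hb hs
    · rw [hs', Set.ncard_insert_of_notMem (s := {v | v ∈ w.support}) (by simpa using h2'), hc]

theorem stmt_aux {V : Type*} [Fintype V] (G : SimpleGraph V) [DecidableRel G.Adj]
    (k : ℕ) (S : Set V) (hk : S.ncard ≤ k)
    (hS : (G.induce S).Connected) {x : V} (hx : x ∈ S) :
    S = {x} ∨ S ∈ walkSets G (2 * k - 2) x := by
  classical
  have hpos : 0 < S.ncard := (Set.ncard_pos).2 ⟨x, hx⟩
  obtain ⟨w, hl, hs, hc⟩ := grow_walk G S hS hx (S.ncard - 1) (by omega)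
  have he : {v | v ∈ w.support} = S := Set.eq_of_subset_of_ncard_le hs (by omega)
  by_cases h1 : S.ncard = 1
  · left
    obtain ⟨a, rfl⟩ := Set.ncard_eq_one.1 h1
    simp at hx; simp [hx]
  · right
    obtain ⟨w', hl', hs'⟩ := extend_walk G w (by omega) (k - S.ncard)
    have := support_mem_walkSets G w'
    simp only [hs', he] at this
    convert this using 2
    omega

/-- The number of connected vertex subsets of size at most `k` intersecting a set `X`,
in a graph of maximum degree at most `d`, is at most `(d ^ (2 * k - 2) + 1) * |X|`. -/
theorem stmt_1 {V : Type*} [Fintype V] (G : SimpleGraph V) [DecidableRel G.Adj]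
    (d k : ℕ) (hk : 1 ≤ k) (hdeg : ∀ v : V, G.degree v ≤ d) (X : Set V) :
    {S : Set V | S.ncard ≤ k ∧ (G.induce S).Connected ∧ (S ∩ X).Nonempty}.ncard ≤
      (d ^ (2 * k - 2) + 1) * X.ncard := by
  classical
  let F : Finset (Set V) := X.toFinset.biUnion fun x => insert {x} (walkSets G (2 * k - 2) x)
  have hsub : {S : Set V | S.ncard ≤ k ∧ (G.induce S).Connected ∧ (S ∩ X).Nonempty} ⊆
      (F : Set (Set V)) := by
    rintro S ⟨h1, h2, x, hxS, hxX⟩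
    have := stmt_aux G k S h1 h2 hxS
    simp only [F, Finset.mem_coe, Finset.mem_biUnion, Finset.mem_insert]
    exact ⟨x, by simpa using hxX, this⟩
  refine (Set.ncard_le_ncard hsub (Finset.finite_toSet F)).trans ?_
  rw [Set.ncard_coe_finset, mul_comm, Set.ncard_eq_toFinset_card']
  refine Finset.card_biUnion_le_card_mul _ _ _ ?_
  intro x _
  exact (Finset.card_insert_le _ _).trans (Nat.succ_le_succ (walkSets_card G d hdeg _ x))
end

section
/- Every triangle-free finite simple graph of twin-width at most d admits a proper coloring with at most d + 2 colors; that is, its chromatic number is at most d + 2. -/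
variable {V : Type*}

/-- Two vertex sets are homogeneous w.r.t. `G`: fully adjacent or fully non-adjacent. -/
def SimpleGraph.Homog (G : SimpleGraph V) (P Q : Set V) : Prop :=
  (∀ x ∈ P, ∀ y ∈ Q, G.Adj x y) ∨ (∀ x ∈ P, ∀ y ∈ Q, ¬ G.Adj x y)

/-- The red degree of a part `P` of a partition `C` w.r.t. `G`: the number of other
parts that are neither fully adjacent nor fully non-adjacent to `P`. -/
noncomputable def SimpleGraph.redDegree (G : SimpleGraph V) (C : Set (Set V))
    (P : Set V) : ℕ :=
  {Q | Q ∈ C ∧ Q ≠ P ∧ ¬ G.Homog P Q}.ncard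

/-- `C` is a partition of the vertex set into nonempty parts. -/
def IsVPartition (C : Set (Set V)) : Prop :=
  (∀ P ∈ C, P.Nonempty) ∧ ∀ v : V, ∃! P, P ∈ C ∧ v ∈ P

/-- `D` is obtained from `C` by contracting (merging) two distinct parts. -/
def MergeStep (C D : Set (Set V)) : Prop :=
  ∃ A ∈ C, ∃ B ∈ C, A ≠ B ∧ D = (C \ {A, B}) ∪ {A ∪ B}

/-- `G` has twin-width at most `d`: there is a contraction sequence, from the partition
into singletons down to the trivial one-part partition, merging two parts at a time,
in which every trigraph encountered (every partition in the sequence) has red degree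
at most `d`. -/
def TwwLe [Fintype V] (G : SimpleGraph V) (d : ℕ) : Prop :=
  ∃ seq : ℕ → Set (Set V),
    seq 0 = Set.range (fun v : V => ({v} : Set V)) ∧
    seq (Fintype.card V - 1) = {Set.univ} ∧
    (∀ i < Fintype.card V - 1, MergeStep (seq i) (seq (i + 1))) ∧
    ∀ i ≤ Fintype.card V - 1, IsVPartition (seq i) ∧
      ∀ P ∈ seq i, G.redDegree (seq i) P ≤ d

/-- The twin-width of `G`. -/
noncomputable def tww [Fintype V] (G : SimpleGraph V) : ℕ := sInf {d | TwwLe G d}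

def SamePart (C : Set (Set V)) (x y : V) : Prop := ∃ P ∈ C, x ∈ P ∧ y ∈ P

def GoodCol (G : SimpleGraph V) (C : Set (Set V)) {n : ℕ} (f : V → Fin n) : Prop :=
  (∀ x y, SamePart C x y → f x = f y) ∧ ∀ x y, G.Adj x y → ¬ SamePart C x y → f x ≠ f y

lemma samePart_iff {C : Set (Set V)} {A B : Set V} (hA : A ∈ C) (hB : B ∈ C) (x y : V) :
    SamePart ((C \ {A, B}) ∪ {A ∪ B}) x y ↔
      SamePart C x y ∨ (x ∈ A ∪ B ∧ y ∈ A ∪ B) := by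
  constructor
  · rintro ⟨P, hP | hP, hx, hy⟩
    · exact Or.inl ⟨P, hP.1, hx, hy⟩
    · rw [Set.mem_singleton_iff] at hP
      subst hP
      exact Or.inr ⟨hx, hy⟩
  · rintro (⟨P, hP, hx, hy⟩ | ⟨hx, hy⟩)
    · by_cases h : P ∈ ({A, B} : Set (Set V))
      · rcases h with h | h
        · subst h
          exact ⟨_, Or.inr rfl, Or.inl hx, Or.inl hy⟩
        · rw [Set.mem_singleton_iff] at h
          subst h
          exact ⟨_, Or.inr rfl, Or.inr hx, Or.inr hy⟩
      · exact ⟨P, Or.inl ⟨hP, h⟩, hx, hy⟩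
    · exact ⟨_, Or.inr rfl, hx, hy⟩

lemma good_step [Fintype V] (G : SimpleGraph V) (d : ℕ) (htri : G.CliqueFree 3)
    (C D : Set (Set V)) (hC : IsVPartition C)
    (hred : ∀ P ∈ D, G.redDegree D P ≤ d) (hm : MergeStep C D)
    (h : ∃ f : V → Fin (d + 2), GoodCol G D f) : ∃ f : V → Fin (d + 2), GoodCol G C f := by
  classical
  obtain ⟨f, hf1, hf2⟩ := h
  obtain ⟨A, hA, B, hB, hAB, rfl⟩ := hm
  simp only [samePart_iff hA hB] at hf1 hf2
  have huniq : ∀ P ∈ C, ∀ Q ∈ C, ∀ v, v ∈ P → v ∈ Q → P = Q := fun P hP Q hQ v h1 h2 =>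
    (hC.2 v).unique ⟨hP, h1⟩ ⟨hQ, h2⟩
  by_cases hE : ∃ a ∈ A, ∃ b ∈ B, G.Adj a b
  · obtain ⟨a, ha, b, hb, hab⟩ := hE
    set D := (C \ {A, B}) ∪ {A ∪ B} with hD
    have hZ : A ∪ B ∈ D := Or.inr rfl
    set N := {Q | Q ∈ D ∧ Q ≠ A ∪ B ∧ ¬ G.Homog (A ∪ B) Q} with hN
    have hNd : N.ncard ≤ d := hred _ hZ
    let g : Set V → Fin (d + 2) := fun Q => if h : Q.Nonempty then f h.some else f a
    have hcard : (insert (f a) (g '' N)).ncard ≤ d + 1 :=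
      (Set.ncard_insert_le _ _).trans
        (Nat.succ_le_succ ((Set.ncard_image_le (Set.toFinite N)).trans hNd))
    obtain ⟨c, hc⟩ : ∃ c, c ∉ insert (f a) (g '' N) := by
      by_contra! hall
      rw [Set.eq_univ_of_forall hall, Set.ncard_univ, Nat.card_eq_fintype_card,
        Fintype.card_fin] at hcard
      omega
    have key : ∀ x ∈ B, ∀ y, y ∉ B → G.Adj x y → c ≠ f y := by
      intro x hx y hy hxy hcy
      apply hc
      by_cases hyA : y ∈ A
      · left
        rw [hcy]
        exact hf1 _ _ (Or.inr ⟨Or.inl hyA, Or.inl ha⟩)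
      · right
        obtain ⟨Q, ⟨hQ, hyQ⟩, -⟩ := hC.2 y
        have hQA : Q ≠ A := fun e => hyA (e ▸ hyQ)
        have hQB : Q ≠ B := fun e => hy (e ▸ hyQ)
        refine ⟨Q, ⟨Or.inl ⟨hQ, by simp [hQA, hQB]⟩, ?_, ?_⟩, ?_⟩
        · rintro rfl
          exact hyQ.elim hyA hy
        · rintro (hh | hh)
          · exact htri {a, b, y} (SimpleGraph.is3Clique_triple_iff.2
              ⟨hab, hh a (Or.inl ha) y hyQ, hh b (Or.inr hb) y hyQ⟩)
          · exact hh x (Or.inr hx) y hyQ hxy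
        · have hne : Q.Nonempty := ⟨y, hyQ⟩
          simp only [g, dif_pos hne]
          rw [hcy]
          exact hf1 _ _ (Or.inl ⟨Q, hQ, hne.some_mem, hyQ⟩)
    refine ⟨fun x => if x ∈ B then c else f x, ?_, ?_⟩
    · rintro x y ⟨P, hP, hx, hy⟩
      by_cases hPB : P = B
      · subst hPB
        simp [hx, hy]
      · have hx' : x ∉ B := fun h => hPB (huniq P hP B hB x hx h)
        have hy' : y ∉ B := fun h => hPB (huniq P hP B hB y hy h)
        simp only [hx', hy', if_false]
        exact hf1 _ _ (Or.inl ⟨P, hP, hx, hy⟩)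
    · intro x y hxy hns
      by_cases hx : x ∈ B <;> by_cases hy : y ∈ B
      · exact absurd ⟨B, hB, hx, hy⟩ hns
      · simpa [hx, hy] using key x hx y hy hxy
      · simpa [hx, hy] using (key y hy x hx hxy.symm).symm
      · simp only [hx, hy, if_false]
        refine hf2 x y hxy ?_
        rintro (h | ⟨h1, h2⟩)
        · exact hns h
        · exact hns ⟨A, hA, h1.resolve_right hx, h2.resolve_right hy⟩
  · push Not at hE
    refine ⟨f, fun x y h => hf1 x y (Or.inl h), fun x y hxy hns => hf2 x y hxy ?_⟩
    rintro (h | ⟨h1 | h1, h2 | h2⟩)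
    · exact hns h
    · exact hns ⟨A, hA, h1, h2⟩
    · exact hE x h1 y h2 hxy
    · exact hE y h2 x h1 hxy.symm
    · exact hns ⟨B, hB, h1, h2⟩

/-- Every triangle-free graph of twin-width at most `d` is properly
`(d + 2)`-colorable; its chromatic number is at most `d + 2`. -/
theorem stmt_3 {V : Type*} [Fintype V] (G : SimpleGraph V) (d : ℕ)
    (htri : G.CliqueFree 3) (htww : TwwLe G d) :
    G.Colorable (d + 2) ∧ G.chromaticNumber ≤ ((d + 2 : ℕ) : ℕ∞) := by
  obtain ⟨seq, h0, h1, hm, hp⟩ := htww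
  have key : ∀ k ≤ Fintype.card V - 1,
      ∃ f : V → Fin (d + 2), GoodCol G (seq (Fintype.card V - 1 - k)) f := by
    intro k
    induction k with
    | zero =>
      intro _
      refine ⟨fun _ => 0, fun _ _ _ => rfl, fun x y _ hns => absurd ?_ hns⟩
      rw [Nat.sub_zero, h1]
      exact ⟨Set.univ, rfl, trivial, trivial⟩
    | succ k ih =>
      intro hk
      have e : Fintype.card V - 1 - k = Fintype.card V - 1 - (k + 1) + 1 := by omega
      have ih' := ih (by omega)
      rw [e] at ih'
      exact good_step G d htri _ _ (hp _ (by omega)).1 (hp _ (by omega)).2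
        (hm _ (by omega)) ih'
  obtain ⟨f, -, hf⟩ := key _ le_rfl
  rw [Nat.sub_self, h0] at hf
  have hcol : G.Colorable (d + 2) := by
    refine ⟨SimpleGraph.Coloring.mk f ?_⟩
    intro x y hxy
    refine hf x y hxy ?_
    rintro ⟨P, ⟨v, rfl⟩, hx, hy⟩
    simp only [Set.mem_singleton_iff] at hx hy
    exact hxy.ne (hx.trans hy.symm)
  exact ⟨hcol, hcol.chromaticNumber_le⟩
end

section
/- For every integer t ≥ 3, every finite simple graph that contains no clique on t vertices and has twin-width at most d admits a proper coloring with at most (d + 2)^(t−2) colors; that is, its chromatic number is at most (d + 2)^(t−2). -/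
variable {V : Type*}

/-- Uniqueness of parts. -/
theorem part_unique {C : Set (Set V)} (hC : IsVPartition C) {P Q : Set V} (hP : P ∈ C)
    (hQ : Q ∈ C) {x : V} (hxP : x ∈ P) (hxQ : x ∈ Q) : P = Q :=
  (hC.2 x).unique ⟨hP, hxP⟩ ⟨hQ, hxQ⟩

/-- Earlier parts are contained in later ones. -/
theorem seq_refine {N : ℕ} {seq : ℕ → Set (Set V)}
    (hm : ∀ i < N, MergeStep (seq i) (seq (i + 1)))
    {i j : ℕ} (hij : i ≤ j) (hj : j ≤ N) {P : Set V} (hP : P ∈ seq i) :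
    ∃ Q ∈ seq j, P ⊆ Q := by
  induction j, hij using Nat.le_induction with
  | base => exact ⟨P, hP, subset_rfl⟩
  | succ j hij ih =>
    obtain ⟨Q, hQ, hPQ⟩ := ih (by omega)
    obtain ⟨A, hA, B, hB, hAB, hD⟩ := hm j (by omega)
    rw [hD]
    by_cases h : Q = A ∨ Q = B
    · refine ⟨A ∪ B, Or.inr rfl, ?_⟩
      rcases h with rfl | rfl
      · exact hPQ.trans Set.subset_union_left
      · exact hPQ.trans Set.subset_union_right
    · exact ⟨Q, Or.inl ⟨hQ, h⟩, hPQ⟩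

theorem seq_laminar {N : ℕ} {seq : ℕ → Set (Set V)}
    (hm : ∀ i < N, MergeStep (seq i) (seq (i + 1)))
    (hp : ∀ i ≤ N, IsVPartition (seq i))
    {i j : ℕ} (hij : i ≤ j) (hj : j ≤ N) {P Q : Set V} (hP : P ∈ seq i) (hQ : Q ∈ seq j)
    {x : V} (hxP : x ∈ P) (hxQ : x ∈ Q) : P ⊆ Q := by
  obtain ⟨Q', hQ', hPQ'⟩ := seq_refine hm hij hj hP
  rwa [part_unique (hp j hj) hQ hQ' hxQ (hPQ' hxP)]

/-- `P` contains no clique of `G` of size `m`. -/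
def FreeOn (G : SimpleGraph V) (m : ℕ) (P : Set V) : Prop :=
  ∀ S : Finset V, (S : Set V) ⊆ P → ¬ G.IsNClique m S

/-- The subgraph of edges lying inside a part with no clique of size `m`. -/
def innerGraph (G : SimpleGraph V) (N : ℕ) (seq : ℕ → Set (Set V)) (m : ℕ) :
    SimpleGraph V where
  Adj u v := G.Adj u v ∧ ∃ i ≤ N, ∃ P ∈ seq i, u ∈ P ∧ v ∈ P ∧ FreeOn G m P
  symm := ⟨fun _ _ h => ⟨h.1.symm, by
    obtain ⟨_, i, hi, P, hP, hu, hv, hf⟩ := h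
    exact ⟨i, hi, P, hP, hv, hu, hf⟩⟩⟩
  loopless := ⟨fun _ h => G.irrefl h.1⟩

theorem innerGraph_cliqueFree (G : SimpleGraph V) {N : ℕ} {seq : ℕ → Set (Set V)}
    (hm : ∀ i < N, MergeStep (seq i) (seq (i + 1)))
    (hp : ∀ i ≤ N, IsVPartition (seq i)) (k : ℕ) :
    (innerGraph G N seq (k + 2)).CliqueFree (k + 2) := by
  intro S hS
  have hSG : G.IsNClique (k + 2) S :=
    ⟨fun x hx y hy hxy => (hS.1 hx hy hxy).1, hS.2⟩
  obtain ⟨u, hu, w, hw, huw⟩ := Finset.one_lt_card.1 (by rw [hS.2]; omega : 1 < S.card)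
  have key : ∀ T : Finset V, T ⊆ S → ∃ i ≤ N, ∃ P ∈ seq i, u ∈ P ∧ FreeOn G (k + 2) P ∧
      (T : Set V) ⊆ P := by
    classical
    intro T
    induction T using Finset.induction_on with
    | empty =>
      intro _
      obtain ⟨_, i, hi, P, hP, h1, h2, hf⟩ := hS.1 hu hw huw
      exact ⟨i, hi, P, hP, h1, hf, by simp⟩
    | insert v T hv ih =>
      intro hT
      obtain ⟨i, hi, P, hP, h1, hf, hTP⟩ := ih ((Finset.subset_insert _ _).trans hT)
      have hvS : v ∈ S := hT (Finset.mem_insert_self _ _)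
      by_cases huv : u = v
      · subst huv
        refine ⟨i, hi, P, hP, h1, hf, ?_⟩
        rw [Finset.coe_insert]
        exact Set.insert_subset h1 hTP
      · obtain ⟨_, j, hj, Q, hQ, h3, h4, hf'⟩ := hS.1 hu hvS huv
        rcases le_total i j with hij | hij
        · refine ⟨j, hj, Q, hQ, h3, hf', ?_⟩
          rw [Finset.coe_insert]
          exact Set.insert_subset h4 (hTP.trans (seq_laminar hm hp hij hj hP hQ h1 h3))
        · refine ⟨i, hi, P, hP, h1, hf, ?_⟩
          rw [Finset.coe_insert]
          exact Set.insert_subset (seq_laminar hm hp hij hi hQ hP h3 h1 h4) hTP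
  obtain ⟨i, hi, P, hP, h1, hf, hSP⟩ := key S subset_rfl
  exact hf S hSP hSG

theorem innerGraph_homog (G : SimpleGraph V) {N : ℕ} {seq : ℕ → Set (Set V)}
    (hm : ∀ i < N, MergeStep (seq i) (seq (i + 1)))
    (hp : ∀ i ≤ N, IsVPartition (seq i)) (m : ℕ) {i : ℕ} (hi : i ≤ N) {P Q : Set V}
    (hP : P ∈ seq i) (hQ : Q ∈ seq i) (hPQ : Q ≠ P) (h : G.Homog P Q) :
    (innerGraph G N seq m).Homog P Q := by
  rcases h with h | h
  · by_cases he : ∃ x ∈ P, ∃ y ∈ Q, (innerGraph G N seq m).Adj x y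
    · obtain ⟨x, hx, y, hy, -, j, hj, M, hM, hxM, hyM, hf⟩ := he
      left
      rcases le_total i j with hij | hij
      · intro a ha b hb
        exact ⟨h a ha b hb, j, hj, M, hM, seq_laminar hm hp hij hj hP hM hx hxM ha,
          seq_laminar hm hp hij hj hQ hM hy hyM hb, hf⟩
      · exact absurd (part_unique (hp i hi) hQ hP hy
          (seq_laminar hm hp hij hi hM hP hxM hx hyM)) hPQ
    · right
      intro x hx y hy hxy
      exact he ⟨x, hx, y, hy, hxy⟩
  · right
    intro x hx y hy hxy
    exact h x hx y hy hxy.1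

theorem innerGraph_redDegree [Fintype V] (G : SimpleGraph V) {N : ℕ} {seq : ℕ → Set (Set V)}
    (hm : ∀ i < N, MergeStep (seq i) (seq (i + 1)))
    (hp : ∀ i ≤ N, IsVPartition (seq i)) (m : ℕ) {i : ℕ} (hi : i ≤ N) {P : Set V}
    (hP : P ∈ seq i) :
    (innerGraph G N seq m).redDegree (seq i) P ≤ G.redDegree (seq i) P := by
  refine Set.ncard_le_ncard ?_ (Set.toFinite _)
  rintro Q ⟨hQ, hne, hh⟩
  exact ⟨hQ, hne, fun h => hh (innerGraph_homog G hm hp m hi hP hQ hne h)⟩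

/-- A part with an edge and a complete join to a large clique contradicts freeness. -/
theorem not_homog_of_clique (G : SimpleGraph V) {m : ℕ} (hG : G.CliqueFree (m + 1))
    {Z Q : Set V} (hZ : ¬ FreeOn G m Z) {x y : V} (hx : x ∈ Z) (hy : y ∈ Q)
    (hxy : G.Adj x y) : ¬ G.Homog Z Q := by
  classical
  rintro (h | h)
  · unfold FreeOn at hZ
    push Not at hZ
    obtain ⟨S, hSZ, hS⟩ := hZ
    exact hG _ (hS.insert (a := y) fun b hb => (h b (hSZ hb) y hy).symm)
  · exact h x hx y hy hxy

theorem exists_coloring [Fintype V] (G : SimpleGraph V) {N d m : ℕ} {seq : ℕ → Set (Set V)}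
    (hlast : seq N = {Set.univ})
    (hm : ∀ i < N, MergeStep (seq i) (seq (i + 1)))
    (hp : ∀ i ≤ N, IsVPartition (seq i))
    (hr : ∀ i ≤ N, ∀ P ∈ seq i, G.redDegree (seq i) P ≤ d)
    (hG : G.CliqueFree (m + 1)) (i : ℕ) (hi : i ≤ N) :
    ∃ c : Set V → Fin (d + 2), ∀ P ∈ seq i, ∀ Q ∈ seq i, P ≠ Q → c P = c Q →
      ∀ x ∈ P, ∀ y ∈ Q, G.Adj x y → (innerGraph G N seq m).Adj x y := by
  classical
  induction hi using Nat.decreasingInduction with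
  | self =>
    refine ⟨fun _ => 0, ?_⟩
    rw [hlast]
    rintro P rfl Q rfl h
    exact absurd rfl h
  | of_succ i hi ih =>
    obtain ⟨c, hc⟩ := ih
    obtain ⟨A, hA, B, hB, hAB, hD⟩ := hm i hi
    have hpi := hp i hi.le
    have hZ : A ∪ B ∈ seq (i + 1) := by rw [hD]; exact Or.inr rfl
    have hother : ∀ Q ∈ seq i, Q ≠ A → Q ≠ B → Q ∈ seq (i + 1) ∧ Q ≠ A ∪ B := by
      intro Q hQ h1 h2
      refine ⟨by rw [hD]; exact Or.inl ⟨hQ, by simp [h1, h2]⟩, ?_⟩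
      rintro rfl
      obtain ⟨a, ha⟩ := hpi.1 A hA
      exact h1 (part_unique hpi hQ hA (Or.inl ha) ha)
    obtain ⟨γ, hγ1, hγ2⟩ : ∃ γ : Fin (d + 2),
        (γ = c (A ∪ B) → ∀ x ∈ A, ∀ y ∈ B, G.Adj x y → (innerGraph G N seq m).Adj x y) ∧
        (∀ Q ∈ seq (i + 1), Q ≠ A ∪ B → γ = c Q → ∀ x ∈ B, ∀ y ∈ Q, G.Adj x y →
          (innerGraph G N seq m).Adj x y) := by
      by_cases hf : FreeOn G m (A ∪ B)
      · refine ⟨c (A ∪ B), fun _ x hx y hy hxy => ?_, fun Q hQ hne hcc x hx y hy hxy => ?_⟩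
        · exact ⟨hxy, i + 1, hi, A ∪ B, hZ, Or.inl hx, Or.inr hy, hf⟩
        · exact hc _ hZ Q hQ hne.symm hcc x (Or.inr hx) y hy hxy
      · set R : Set (Set V) :=
          {Q | Q ∈ seq (i + 1) ∧ Q ≠ A ∪ B ∧ ¬ G.Homog (A ∪ B) Q} with hR
        have hRc : R.ncard ≤ d := hr (i + 1) hi _ hZ
        have h1 : (insert (c (A ∪ B)) (c '' R)).ncard ≤ d + 1 :=
          (Set.ncard_insert_le _ _).trans
            (Nat.succ_le_succ ((Set.ncard_image_le (Set.toFinite R)).trans hRc))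
        obtain ⟨γ, hγ⟩ : ∃ γ, γ ∉ insert (c (A ∪ B)) (c '' R) := by
          by_contra hcon
          push Not at hcon
          rw [Set.eq_univ_of_forall hcon, Set.ncard_univ, Nat.card_eq_fintype_card,
            Fintype.card_fin] at h1
          omega
        refine ⟨γ, fun h => absurd (Or.inl h) hγ, fun Q hQ hne hcc x hx y hy hxy => ?_⟩
        exact absurd (Or.inr ⟨Q, ⟨hQ, hne,
          not_homog_of_clique G hG hf (Or.inr hx) hy hxy⟩, hcc.symm⟩) hγ
    refine ⟨fun P => if P = A then c (A ∪ B) else if P = B then γ else c P, ?_⟩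
    have hBA : B ≠ A := hAB.symm
    intro P hP Q hQ hPQ hcc x hx y hy hxy
    by_cases hPA : P = A
    · subst hPA
      by_cases hQB : Q = B
      · subst hQB
        simp only [if_true, if_neg hBA] at hcc
        exact hγ1 hcc.symm x hx y hy hxy
      · obtain ⟨h1, h2⟩ := hother Q hQ hPQ.symm hQB
        simp only [if_true, if_neg hPQ.symm, if_neg hQB] at hcc
        exact hc _ hZ Q h1 h2.symm hcc x (Or.inl hx) y hy hxy
    by_cases hPB : P = B
    · subst hPB
      by_cases hQA : Q = A
      · subst hQA
        simp only [if_true, if_neg hBA] at hcc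
        exact (hγ1 hcc y hy x hx hxy.symm).symm
      · obtain ⟨h1, h2⟩ := hother Q hQ hQA hPQ.symm
        simp only [if_true, if_neg hBA, if_neg hQA, if_neg hPQ.symm] at hcc
        exact hγ2 Q h1 h2 hcc x hx y hy hxy
    obtain ⟨h1, h2⟩ := hother P hP hPA hPB
    by_cases hQA : Q = A
    · subst hQA
      simp only [if_true, if_neg hPA, if_neg hPB] at hcc
      exact hc P h1 _ hZ h2 hcc x hx y (Or.inl hy) hxy
    by_cases hQB : Q = B
    · subst hQB
      simp only [if_true, if_neg hPA, if_neg hPB, if_neg hBA] at hcc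
      exact (hγ2 P h1 h2 hcc.symm y hy x hx hxy.symm).symm
    obtain ⟨h3, h4⟩ := hother Q hQ hQA hQB
    simp only [if_neg hPA, if_neg hPB, if_neg hQA, if_neg hQB] at hcc
    exact hc P h1 Q h3 hPQ hcc x hx y hy hxy

theorem colorable_aux [Fintype V] {N d : ℕ} {seq : ℕ → Set (Set V)}
    (hfirst : seq 0 = Set.range (fun v : V => ({v} : Set V)))
    (hlast : seq N = {Set.univ})
    (hm : ∀ i < N, MergeStep (seq i) (seq (i + 1)))
    (hp : ∀ i ≤ N, IsVPartition (seq i)) (k : ℕ) :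
    ∀ G : SimpleGraph V, (∀ i ≤ N, ∀ P ∈ seq i, G.redDegree (seq i) P ≤ d) →
      G.CliqueFree (k + 2) → G.Colorable ((d + 2) ^ k) := by
  induction k with
  | zero =>
    intro G _ hG
    have hbot : G = ⊥ := SimpleGraph.cliqueFree_two.1 hG
    subst hbot
    exact ⟨SimpleGraph.Coloring.mk (fun _ => ⟨0, by simp⟩) (fun h => absurd h (by simp))⟩
  | succ k ih =>
    intro G hr hG
    obtain ⟨c, hc⟩ := exists_coloring G hlast hm hp hr hG 0 (Nat.zero_le _)
    obtain ⟨c'⟩ := ih (innerGraph G N seq (k + 2))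
      (fun i hi P hP => (innerGraph_redDegree G hm hp _ hi hP).trans (hr i hi P hP))
      (innerGraph_cliqueFree G hm hp k)
    have col : G.Coloring (Fin (d + 2) × Fin ((d + 2) ^ k)) :=
      SimpleGraph.Coloring.mk (fun v => (c {v}, c' v)) (by
        intro u v huv heq
        rw [Prod.mk.injEq] at heq
        have hin : ∀ w : V, ({w} : Set V) ∈ seq 0 := fun w => by rw [hfirst]; exact ⟨w, rfl⟩
        exact c'.valid (hc {u} (hin u) {v} (hin v)
          (fun h => huv.ne (Set.singleton_injective h)) heq.1 u rfl v rfl huv) heq.2)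
    have := col.colorable
    rwa [Fintype.card_prod, Fintype.card_fin, Fintype.card_fin, ← pow_succ'] at this

/-- For `t ≥ 3`, every `K_t`-free graph of twin-width at most `d` is properly
colorable with at most `(d + 2) ^ (t - 2)` colors. -/
theorem stmt_4 {V : Type*} [Fintype V] (G : SimpleGraph V) (d t : ℕ) (ht : 3 ≤ t)
    (hfree : G.CliqueFree t) (htww : TwwLe G d) :
    G.Colorable ((d + 2) ^ (t - 2)) ∧
      G.chromaticNumber ≤ (((d + 2) ^ (t - 2) : ℕ) : ℕ∞) := by
  obtain ⟨seq, hfirst, hlast, hm, hpr⟩ := htww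
  have hcol : G.Colorable ((d + 2) ^ (t - 2)) := by
    refine colorable_aux hfirst hlast hm (fun i hi => (hpr i hi).1) (t - 2) G
      (fun i hi => (hpr i hi).2) ?_
    rwa [Nat.sub_add_cancel (by omega)]
  exact ⟨hcol, hcol.chromaticNumber_le⟩
end

section
/- For every integer t ≥ 3 and every finite simple graph G of twin-width at most d whose clique number is at most t − 1, G contains an independent set of size at least |V(G)| / (d + 2)^(t−2). -/
variable {V : Type*}

/-- Greedy colouring of a structure whose later degrees are at most `m`. -/
theorem greedy_aux {β : Type*} [DecidableEq β] (h : β → ℕ) (R : β → β → Prop)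
    (hR : ∀ a b, R a b → R b a) (m : ℕ) (T : Finset β)
    (hT : ∀ b ∈ T, {b' | b' ∈ T ∧ b' ≠ b ∧ h b ≤ h b' ∧ R b b'}.ncard ≤ m) :
    ∃ q : β → Fin (m + 1), ∀ a ∈ T, ∀ b ∈ T, a ≠ b → R a b → q a ≠ q b := by
  classical
  induction T using Finset.induction_on_min_value h with
  | empty => exact ⟨fun _ => 0, by simp⟩
  | insert a s ha hmin ih =>
    obtain ⟨q, hq⟩ := ih (by
      intro b hb
      refine le_trans (Set.ncard_le_ncard ?_ ?_) (hT b (Finset.mem_insert_of_mem hb))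
      · rintro x ⟨h1, h2⟩
        exact ⟨Finset.mem_insert_of_mem h1, h2⟩
      · exact (Finset.finite_toSet (insert a s)).subset (fun x hx => hx.1))
    have hcard : ((s.filter (fun b => R a b)).image q).card < Fintype.card (Fin (m + 1)) := by
      rw [Fintype.card_fin]
      refine Nat.lt_succ_of_le (Finset.card_image_le.trans ?_)
      rw [← Set.ncard_coe_finset]
      refine le_trans (Set.ncard_le_ncard ?_ ?_) (hT a (Finset.mem_insert_self _ _))
      · intro x hx
        simp only [Finset.coe_filter, Set.mem_ofPred_eq] at hx
        refine ⟨Finset.mem_insert_of_mem hx.1, ?_, hmin x hx.1, hx.2⟩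
        rintro rfl
        exact ha hx.1
      · exact (Finset.finite_toSet (insert a s)).subset (fun x hx => hx.1)
    obtain ⟨col, hcol⟩ : ∃ c, c ∉ (s.filter (fun b => R a b)).image q := by
      by_contra hcon
      push Not at hcon
      rw [Finset.eq_univ_of_forall hcon, Finset.card_univ] at hcard
      exact lt_irrefl _ hcard
    have hcol' : ∀ x ∈ s, R a x → q x ≠ col := by
      intro x hx hr he
      exact hcol (Finset.mem_image.2 ⟨x, Finset.mem_filter.2 ⟨hx, hr⟩, he⟩)
    have hne : ∀ x ∈ s, x ≠ a := by
      rintro x hx rfl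
      exact ha hx
    refine ⟨Function.update q a col, ?_⟩
    intro x hx y hy hxy hr
    rcases Finset.mem_insert.1 hx with hxa | hxs
    · rcases Finset.mem_insert.1 hy with hya | hys
      · exact absurd (hxa.trans hya.symm) hxy
      · rw [hxa, Function.update_self, Function.update_of_ne (hne y hys)]
        exact (hcol' y hys (hxa ▸ hr)).symm
    · rcases Finset.mem_insert.1 hy with hya | hys
      · rw [hya, Function.update_self, Function.update_of_ne (hne x hxs)]
        exact hcol' x hxs (hR _ _ (hya ▸ hr))
      · rw [Function.update_of_ne (hne x hxs), Function.update_of_ne (hne y hys)]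
        exact hq x hxs y hys hxy hr

/-- The block colouring: split `W` into blocks, each a singleton or complete to a vertex of `W`,
so that the quotient is `(d+2)`-colourable. -/
theorem block_aux {V : Type*} [Fintype V] (G : SimpleGraph V) (d N : ℕ) (p : ℕ → V → Set V)
    (h1 : ∀ i v w, w ∈ p i v ↔ p i w = p i v)
    (h2 : ∀ v, p 0 v = {v})
    (h3 : ∀ i v, N < i → p i v = Set.univ)
    (h4 : ∀ i j, i ≤ j → ∀ v w, p i v = p i w → p j v = p j w)
    (h5 : ∀ i (T : Set (Set V)), {Q | ∃ w, Q = p i w ∧ p (i + 1) w ∈ T}.ncard ≤ T.ncard + 1)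
    (h6 : ∀ i v, {Q | (∃ w, Q = p i w) ∧ Q ≠ p i v ∧ ¬ G.Homog (p i v) Q}.ncard ≤ d)
    (W : Set V) :
    ∃ b : V → Set V, ∃ q : V → Fin (d + 2),
      (∀ v ∈ W, v ∈ b v ∧ b v ⊆ W ∧ (b v = {v} ∨ ∃ y ∈ W, ∀ x ∈ b v, G.Adj x y)) ∧
      (∀ v ∈ W, ∀ w ∈ W, G.Adj v w → b v = b w ∨ q v ≠ q w) := by
  classical
  let black : ℕ → V → Prop := fun i v => ∃ y ∈ W, p i y ≠ p i v ∧
    ∀ x ∈ W, p i x = p i v → ∀ z ∈ W, p i z = p i y → G.Adj x z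
  have hblack : ∀ i v w, p i v = p i w → black i v → black i w := by
    rintro i v w e ⟨y, hy, hne, ha⟩
    exact ⟨y, hy, e ▸ hne, e ▸ ha⟩
  let τ : V → ℕ := fun v => Nat.findGreatest (fun i => black i v) N
  have hτ0 : ∀ v, τ v ≠ 0 → black (τ v) v := fun v hv =>
    Nat.findGreatest_of_ne_zero (P := fun i => black i v) rfl hv
  have hN : ∀ i v, black i v → i ≤ N := by
    rintro i v ⟨y, hy, hne, -⟩
    by_contra hi
    push Not at hi
    exact hne (by rw [h3 i y hi, h3 i v hi])
  have hτle : ∀ i v, black i v → i ≤ τ v := fun i v hb =>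
    Nat.le_findGreatest (hN i v hb) hb
  have hτeq : ∀ v w, p (τ v) w = p (τ v) v → τ w = τ v := by
    intro v w e
    apply le_antisymm
    · by_contra hlt
      push Not at hlt
      have hb := hτ0 w (by omega)
      have := hτle _ _ (hblack _ _ _ (h4 _ _ hlt.le _ _ e) hb)
      omega
    · by_cases h0 : τ v = 0
      · omega
      · exact hτle _ _ (hblack _ _ _ e.symm (hτ0 v h0))
  let b : V → ℕ × Set V := fun v => (τ v, p (τ v) v ∩ W)
  have hbeq : ∀ i y y', i ≤ τ y → p i y' = p i y → b y' = b y := by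
    intro i y y' hi e
    have e' := h4 _ _ hi _ _ e
    have ht := hτeq y y' e'
    simp only [b, ht, e']
  let T : Finset (ℕ × Set V) := (Finset.univ.filter (fun v => v ∈ W)).image b
  let R : ℕ × Set V → ℕ × Set V → Prop := fun a c => ∃ x ∈ a.2, ∃ y ∈ c.2, G.Adj x y
  have hmemb : ∀ v y, y ∈ (b v).2 → y ∈ W ∧ p (τ v) y = p (τ v) v ∧ b y = b v := by
    rintro v y ⟨hy, hyW⟩
    have := (h1 _ _ _).1 hy
    exact ⟨hyW, this, hbeq _ _ _ le_rfl this⟩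
  have hself : ∀ v ∈ W, v ∈ (b v).2 := fun v hv => ⟨(h1 _ _ _).2 rfl, hv⟩
  obtain ⟨q, hq⟩ := greedy_aux (β := ℕ × Set V) Prod.fst R
    (by rintro a c ⟨x, hx, y, hy, h⟩; exact ⟨y, hy, x, hx, h.symm⟩) (d + 1) T (by
    intro b0 hb0
    obtain ⟨v, hv, rfl⟩ := Finset.mem_image.1 hb0
    have hvW : v ∈ W := by simpa using hv
    set i := τ v with hi
    have key : ∀ b' : ℕ × Set V, b' ∈ {b' | b' ∈ T ∧ b' ≠ b v ∧ (b v).1 ≤ b'.1 ∧ R (b v) b'} →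
        ∃ y, y ∈ W ∧ b y = b' ∧ ∃ x ∈ (b v).2, G.Adj x y := by
      rintro b' ⟨hbT, -, -, x, hx, y, hy, hxy⟩
      obtain ⟨w, -, rfl⟩ := Finset.mem_image.1 hbT
      exact ⟨y, (hmemb w y hy).1, (hmemb w y hy).2.2, x, hx, hxy⟩
    have key' : ∀ b' : ℕ × Set V, ∃ y,
        b' ∈ {b' | b' ∈ T ∧ b' ≠ b v ∧ (b v).1 ≤ b'.1 ∧ R (b v) b'} →
        y ∈ W ∧ b y = b' ∧ ∃ x ∈ (b v).2, G.Adj x y := by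
      intro b'
      by_cases hb : b' ∈ {b' | b' ∈ T ∧ b' ≠ b v ∧ (b v).1 ≤ b'.1 ∧ R (b v) b'}
      · obtain ⟨y, hy⟩ := key b' hb
        exact ⟨y, fun _ => hy⟩
      · exact ⟨v, fun h => absurd h hb⟩
    choose Y hY using key'
    have hYW := fun b' hb' => (hY b' hb').1
    have hYb := fun b' hb' => (hY b' hb').2.1
    have hYx := fun b' hb' => (hY b' hb').2.2
    let Red : Set (Set V) :=
      {Q | (∃ w, Q = p (i + 1) w) ∧ Q ≠ p (i + 1) v ∧ ¬ G.Homog (p (i + 1) v) Q}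
    let M : Set (Set V) := {Q | ∃ w, Q = p i w ∧ p (i + 1) w ∈ insert (p (i + 1) v) Red}
    have hM : M.ncard ≤ d + 2 := by
      have ha := h5 i (insert (p (i + 1) v) Red)
      have hb := Set.ncard_insert_le (p (i + 1) v) Red
      have hc : Red.ncard ≤ d := h6 (i + 1) v
      have : M.ncard ≤ (insert (p (i + 1) v) Red).ncard + 1 := ha
      omega
    have hvM : p i v ∈ M := ⟨v, rfl, Set.mem_insert _ _⟩
    have hM' : (M \ {p i v}).ncard ≤ d + 1 := by
      rw [Set.ncard_sdiff_singleton_of_mem hvM]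
      omega
    refine le_trans (Set.ncard_le_ncard_of_injOn (fun b' => p i (Y b')) ?_ ?_ (Set.toFinite _)) hM'
    · intro b' hb'
      have hYW' := hYW b' hb'
      have hYb' := hYb b' hb'
      obtain ⟨x, hx, hxy⟩ := hYx b' hb'
      obtain ⟨hxW, hxp, hxb⟩ := hmemb v x hx
      obtain ⟨hbT, hbne, hbi, -⟩ := hb'
      refine ⟨⟨Y b', rfl, ?_⟩, ?_⟩
      · by_cases hc : p (i + 1) (Y b') = p (i + 1) v
        · rw [hc]; exact Set.mem_insert _ _
        · refine Set.mem_insert_of_mem _ ⟨⟨_, rfl⟩, hc, ?_⟩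
          have hxp' : p (i + 1) x = p (i + 1) v := h4 _ _ (Nat.le_succ i) _ _ hxp
          rintro (hall | hnone)
          · have hbl : black (i + 1) v := ⟨Y b', hYW', hc, fun x' _ hx' z _ hz' =>
              hall x' ((h1 _ _ _).2 hx') z ((h1 _ _ _).2 hz')⟩
            have := hτle _ _ hbl
            omega
          · exact hnone x ((h1 _ _ _).2 hxp') (Y b') ((h1 _ _ _).2 rfl) hxy
      · intro hc
        apply hbne
        rw [← hYb']
        exact hbeq i v (Y b') le_rfl hc
    · intro b1 hb1 b2 hb2 he
      rw [← hYb b1 hb1, ← hYb b2 hb2]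
      refine hbeq i _ _ ?_ he
      have : (b v).1 ≤ (b (Y b2)).1 := by rw [hYb b2 hb2]; exact hb2.2.2.1
      exact this)
  refine ⟨fun v => (b v).2, fun v => q (b v), ?_, ?_⟩
  · intro v hv
    refine ⟨hself v hv, fun x hx => hx.2, ?_⟩
    by_cases h0 : τ v = 0
    · left
      ext x
      simp only [b, h0, h2, Set.mem_inter_iff, Set.mem_singleton_iff]
      constructor
      · exact fun h => h.1
      · rintro rfl; exact ⟨rfl, hv⟩
    · right
      obtain ⟨y, hy, -, ha⟩ := hτ0 v h0
      exact ⟨y, hy, fun x hx => ha x hx.2 ((h1 _ _ _).1 hx.1) y hy rfl⟩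
  · intro v hv w hw hvw
    by_cases hb : b v = b w
    · left; exact congrArg Prod.snd hb
    · right
      exact hq _ (Finset.mem_image_of_mem _ (by simpa using hv)) _
        (Finset.mem_image_of_mem _ (by simpa using hw)) hb ⟨v, hself v hv, w, hself w hw, hvw⟩

theorem color_aux {V : Type*} (G : SimpleGraph V) (d : ℕ)
    (H : ∀ W : Set V, ∃ b : V → Set V, ∃ q : V → Fin (d + 2),
      (∀ v ∈ W, v ∈ b v ∧ b v ⊆ W ∧ (b v = {v} ∨ ∃ y ∈ W, ∀ x ∈ b v, G.Adj x y)) ∧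
      (∀ v ∈ W, ∀ w ∈ W, G.Adj v w → b v = b w ∨ q v ≠ q w)) (k : ℕ) :
    ∀ W : Set V, (∀ s : Finset V, (s : Set V) ⊆ W → ¬ G.IsNClique (k + 2) s) →
      ∃ c : V → (Fin k → Fin (d + 2)), ∀ v ∈ W, ∀ w ∈ W, G.Adj v w → c v ≠ c w := by
  classical
  induction k with
  | zero =>
    intro W hW
    refine ⟨fun _ _ => 0, ?_⟩
    intro v hv w hw hvw
    refine absurd ?_ (hW {v, w} ?_)
    · exact ⟨by
        rw [Finset.coe_pair, SimpleGraph.isClique_pair]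
        exact fun _ => hvw, Finset.card_pair hvw.ne⟩
    · intro x hx
      simp only [Finset.coe_insert, Finset.coe_singleton, Set.mem_insert_iff,
        Set.mem_singleton_iff] at hx
      rcases hx with rfl | rfl <;> assumption
  | succ k ih =>
    intro W hW
    obtain ⟨b, q, hb, hq⟩ := H W
    have hB : ∀ B : Set V, ∃ c : V → (Fin k → Fin (d + 2)),
        (∃ u ∈ W, B = b u) → ∀ v ∈ B, ∀ w ∈ B, G.Adj v w → c v ≠ c w := by
      intro B
      by_cases hu : ∃ u ∈ W, B = b u
      · obtain ⟨u, hu, rfl⟩ := hu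
        obtain ⟨-, hsub, hcase⟩ := hb u hu
        obtain ⟨c, hc⟩ := ih (b u) (by
          intro s hs hcl
          rcases hcase with he | ⟨y, hy, hadj⟩
          · rw [he] at hs
            have : s ⊆ {u} := by
              intro x hx
              simpa using hs hx
            have := Finset.card_le_card this
            rw [hcl.card_eq, Finset.card_singleton] at this
            omega
          · refine hW (insert y s) ?_ (hcl.insert fun x hx => (hadj x (hs hx)).symm)
            rw [Finset.coe_insert]
            exact Set.insert_subset hy (hs.trans hsub))
        exact ⟨c, fun _ => hc⟩
      · exact ⟨fun _ _ => 0, fun h => absurd h hu⟩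
    choose c hc using hB
    refine ⟨fun v => Fin.cons (q v) (c (b v) v), ?_⟩
    intro v hv w hw hvw he
    rw [Fin.cons_inj] at he
    rcases hq v hv w hw hvw with h | h
    · have hwb := (hb w hw).1
      rw [← h] at hwb
      refine hc (b v) ⟨v, hv, rfl⟩ v (hb v hv).1 w hwb hvw ?_
      rw [he.2, h]
    · exact h he.1

theorem parts_aux {V : Type*} [Fintype V] (G : SimpleGraph V) (d : ℕ) (htww : TwwLe G d) :
    ∃ (N : ℕ) (p : ℕ → V → Set V),
    (∀ i v w, w ∈ p i v ↔ p i w = p i v) ∧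
    (∀ v, p 0 v = {v}) ∧
    (∀ i v, N < i → p i v = Set.univ) ∧
    (∀ i j, i ≤ j → ∀ v w, p i v = p i w → p j v = p j w) ∧
    (∀ i (T : Set (Set V)), {Q | ∃ w, Q = p i w ∧ p (i + 1) w ∈ T}.ncard ≤ T.ncard + 1) ∧
    (∀ i v, {Q | (∃ w, Q = p i w) ∧ Q ≠ p i v ∧ ¬ G.Homog (p i v) Q}.ncard ≤ d) := by
  classical
  obtain ⟨seq, hs0, hsN, hstep, hpart⟩ := htww
  set N := Fintype.card V - 1 with hNdef
  have hex : ∀ i v, ∃ P : Set V, (i ≤ N → P ∈ seq i ∧ v ∈ P) ∧ (N < i → P = Set.univ) := by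
    intro i v
    by_cases hi : i ≤ N
    · obtain ⟨P, hP, -⟩ := (hpart i hi).1.2 v
      exact ⟨P, fun _ => hP, fun h => by omega⟩
    · exact ⟨Set.univ, fun h => absurd h hi, fun _ => rfl⟩
  choose p hp hpu using hex
  have huniq : ∀ i, i ≤ N → ∀ P ∈ seq i, ∀ v ∈ P, p i v = P := by
    intro i hi P hP v hv
    exact ((hpart i hi).1.2 v).unique (hp i v hi) ⟨hP, hv⟩
  have hpN : ∀ i v, N ≤ i → p i v = Set.univ := by
    intro i v hi
    rcases hi.eq_or_lt with rfl | hi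
    · have := (hp N v le_rfl).1
      rw [hsN] at this
      exact this
    · exact hpu i v hi
  have h1 : ∀ i v w, w ∈ p i v ↔ p i w = p i v := by
    intro i v w
    by_cases hi : i ≤ N
    · constructor
      · exact huniq i hi _ (hp i v hi).1 w
      · intro h
        rw [← h]
        exact (hp i w hi).2
    · push Not at hi
      simp [hpu i v hi, hpu i w hi]
  -- one step
  have hmerge : ∀ i, i < N → ∃ A B : Set V, ∀ w,
      ((p i w = A ∨ p i w = B) ∧ p (i + 1) w = A ∪ B) ∨
      (p i w ≠ A ∧ p i w ≠ B ∧ p (i + 1) w = p i w ∧ p i w ≠ A ∪ B) := by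
    intro i hi
    obtain ⟨A, hA, B, hB, hAB, hD⟩ := hstep i hi
    refine ⟨A, B, fun w => ?_⟩
    have hw := hp i w hi.le
    by_cases hc : p i w = A ∨ p i w = B
    · left
      refine ⟨hc, huniq (i + 1) hi _ ?_ w ?_⟩
      · rw [hD]; right; rfl
      · rcases hc with h | h
        · left; rw [← h]; exact hw.2
        · right; rw [← h]; exact hw.2
    · right
      push Not at hc
      refine ⟨hc.1, hc.2, huniq (i + 1) hi _ ?_ w hw.2, ?_⟩
      · rw [hD]
        left
        refine ⟨hw.1, ?_⟩
        simp [hc.1, hc.2]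
      · intro hu
        obtain ⟨a, ha⟩ := (hpart i hi.le).1.1 A hA
        have e1 := huniq i hi.le A hA a ha
        have e2 : p i a = p i w := (h1 _ _ _).1 (by rw [hu]; exact Or.inl ha)
        exact hc.1 (e2.symm.trans e1)
  refine ⟨N, p, h1, ?_, hpu, ?_, ?_, ?_⟩
  · intro v
    refine huniq 0 (Nat.zero_le _) _ ?_ v rfl
    rw [hs0]
    exact ⟨v, rfl⟩
  · intro i j hij v w he
    induction j, hij using Nat.le_induction with
    | base => exact he
    | succ j hj ih =>
      by_cases hjN : j < N
      · obtain ⟨A, B, hAB⟩ := hmerge j hjN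
        have hv := hAB v
        have hw := hAB w
        rw [← ih] at hw
        rcases hv with ⟨a, b⟩ | ⟨a, a', b, -⟩ <;> rcases hw with ⟨c, e⟩ | ⟨c, c', e, -⟩
        · rw [b, e]
        · tauto
        · tauto
        · rw [b, e]
      · rw [hpN (j + 1) v (by omega), hpN (j + 1) w (by omega)]
  · intro i T
    by_cases hi : i < N
    · obtain ⟨A, B, hAB⟩ := hmerge i hi
      by_cases hT : A ∪ B ∈ T
      · have hsub : {Q | ∃ w, Q = p i w ∧ p (i + 1) w ∈ T} ⊆
            insert A (insert B (T \ {A ∪ B})) := by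
          rintro Q ⟨w, rfl, hw⟩
          rcases hAB w with ⟨h | h, -⟩ | ⟨ha, hb, h, hc⟩
          · left; exact h
          · right; left; exact h
          · right; right
            exact ⟨h ▸ hw, hc⟩
        have e1 := Set.ncard_le_ncard hsub (Set.toFinite _)
        have e2 := Set.ncard_insert_le A (insert B (T \ {A ∪ B}))
        have e3 := Set.ncard_insert_le B (T \ {A ∪ B})
        have e4 := Set.ncard_sdiff_singleton_add_one hT (Set.toFinite _)
        omega
      · refine le_trans (Set.ncard_le_ncard ?_ (Set.toFinite _)) (Nat.le_succ _)
        rintro Q ⟨w, rfl, hw⟩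
        rcases hAB w with ⟨-, h⟩ | ⟨-, -, h, -⟩
        · exact absurd (h ▸ hw) hT
        · exact h ▸ hw
    · have : {Q | ∃ w, Q = p i w ∧ p (i + 1) w ∈ T} ⊆ {Set.univ} := by
        rintro Q ⟨w, rfl, -⟩
        exact hpN i w (by omega)
      have := Set.ncard_le_ncard this
      rw [Set.ncard_singleton] at this
      omega
  · intro i v
    by_cases hi : i ≤ N
    · refine le_trans (Set.ncard_le_ncard ?_ (Set.toFinite _)) ((hpart i hi).2 _ (hp i v hi).1)
      rintro Q ⟨⟨w, rfl⟩, h⟩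
      exact ⟨(hp i w hi).1, h⟩
    · have : {Q | (∃ w, Q = p i w) ∧ Q ≠ p i v ∧ ¬ G.Homog (p i v) Q} = ∅ := by
        ext Q
        simp only [Set.mem_ofPred_eq, Set.mem_empty_iff_false, iff_false]
        rintro ⟨⟨w, rfl⟩, h, -⟩
        exact h (by rw [hpN i v (by omega), hpN i w (by omega)])
      rw [this]
      simp

/-- For `t ≥ 3`, every graph of twin-width at most `d` with clique number at most
`t - 1` (i.e. `K_t`-free) contains an independent set of size at least
`|V(G)| / (d + 2) ^ (t - 2)`. -/
theorem stmt_5 {V : Type*} [Fintype V] (G : SimpleGraph V) (d t : ℕ) (ht : 3 ≤ t)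
    (hfree : G.CliqueFree t) (htww : TwwLe G d) :
    ∃ S : Finset V, (∀ x ∈ S, ∀ y ∈ S, ¬ G.Adj x y) ∧
      (Fintype.card V : ℝ) / (d + 2 : ℝ) ^ (t - 2) ≤ S.card := by
  classical
  obtain ⟨N, p, h1, h2, h3, h4, h5, h6⟩ := parts_aux G d htww
  obtain ⟨k, rfl⟩ : ∃ k, t = k + 2 := ⟨t - 2, by omega⟩
  obtain ⟨c, hc⟩ := color_aux G d (block_aux G d N p h1 h2 h3 h4 h5 h6) k Set.univ
    (fun s _ => hfree s)
  rw [Nat.add_sub_cancel]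
  obtain ⟨y, hy⟩ := Fintype.exists_le_card_fiber_of_nsmul_le_card (M := ℝ) c
    (b := (Fintype.card V : ℝ) / (d + 2 : ℝ) ^ k) (by
      have : (d + 2 : ℝ) ^ k ≠ 0 := by positivity
      simp only [Fintype.card_pi, Fintype.card_fin, Finset.prod_const, Finset.card_univ,
        nsmul_eq_mul, Nat.cast_pow, Nat.cast_add, Nat.cast_ofNat]
      rw [mul_div_cancel₀ _ this])
  refine ⟨_, ?_, hy⟩
  intro x hx z hz hxz
  simp only [Finset.mem_filter, Finset.mem_univ, true_and] at hx hz
  exact hc x trivial z trivial hxz (hx.trans hz.symm)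
end

section
/- Let G be a finite simple graph on n ≥ 2 vertices with twin-width at most d. Then there exist two disjoint vertex subsets X and Y of G, each of size at least n/(d+4), such that either every vertex of X is adjacent to every vertex of Y, or no vertex of X is adjacent to any vertex of Y. (In particular, the class of graphs of twin-width at most d satisfies the strong Erdős–Hajnal property with ε = 1/(d+4).) -/
variable {V : Type*}

/-- Strong Erdős–Hajnal property for twin-width at most `d`, with `ε = 1 / (d + 4)`:
every graph on `n ≥ 2` vertices of twin-width at most `d` has two disjoint vertex
subsets of size at least `n / (d + 4)` that are fully adjacent or fully non-adjacent. -/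
theorem stmt_6 {V : Type*} [Fintype V] (G : SimpleGraph V) (d : ℕ)
    (hn : 2 ≤ Fintype.card V) (htww : TwwLe G d) :
    ∃ X Y : Finset V, Disjoint X Y ∧
      (Fintype.card V : ℝ) / (d + 4 : ℝ) ≤ X.card ∧
      (Fintype.card V : ℝ) / (d + 4 : ℝ) ≤ Y.card ∧
      ((∀ x ∈ X, ∀ y ∈ Y, G.Adj x y) ∨ (∀ x ∈ X, ∀ y ∈ Y, ¬ G.Adj x y)) := by
  classical
  obtain ⟨seq, h0, h1, hm, hp⟩ := htww
  set n := Fintype.card V with hn'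
  have conv : ∀ X : Finset V, n ≤ (d + 4) * X.card → (n : ℝ) / (d + 4 : ℝ) ≤ X.card := by
    intro X hX
    rw [div_le_iff₀ (by positivity)]
    have : (n : ℝ) ≤ (((d + 4) * X.card : ℕ) : ℝ) := by exact_mod_cast hX
    push_cast at this
    linarith
  have hex : ∃ i, i ≤ n - 1 ∧ ∃ P ∈ seq i, n ≤ (d + 4) * P.toFinset.card := by
    refine ⟨n - 1, le_rfl, Set.univ, by rw [h1]; rfl, ?_⟩
    have key : ∀ P : Set V, P = Set.univ → P.toFinset.card = n := by
      intro P hP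
      have : P.toFinset = Finset.univ := by ext x; rw [Set.mem_toFinset]; simp [hP]
      rw [this]
      rfl
    have := key _ rfl
    nlinarith
  have hspec := Nat.find_spec hex
  have hmin := fun m => Nat.find_min hex (m := m)
  generalize Nat.find hex = i at hspec hmin
  obtain ⟨hi, P, hP, hbig⟩ := hspec
  cases i with
  | zero =>
    rw [h0] at hP
    obtain ⟨v, rfl⟩ := hP
    have hs : n ≤ d + 4 := by simpa using hbig
    obtain ⟨a, b, hab⟩ := Fintype.exists_pair_of_one_lt_card (α := V) (by omega)
    refine ⟨{a}, {b}, by simpa using hab, conv _ (by simpa using hs),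
      conv _ (by simpa using hs), ?_⟩
    by_cases h : G.Adj a b
    · left; simpa using h
    · right; simpa using h
  | succ j =>
    have hsmall : ∀ Q ∈ seq j, (d + 4) * Q.toFinset.card < n := by
      intro Q hQ
      by_contra hc
      exact hmin j (by omega) ⟨by omega, Q, hQ, by omega⟩
    obtain ⟨A, hA, B, hB, hAB, hD⟩ := hm j (by omega)
    obtain ⟨⟨-, hcov⟩, hred⟩ := hp (j + 1) hi
    have hsub : ∀ Q ∈ seq (j + 1), Q ≠ A ∪ B → Q ∈ seq j := by
      intro Q hQ hne
      rw [hD] at hQ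
      rcases hQ with hQ | hQ
      · exact hQ.1
      · exact absurd hQ hne
    have hPe : P = A ∪ B := by
      by_contra hne
      have := hsmall P (hsub P hP hne)
      omega
    have hPc : (d + 4) * P.toFinset.card < 2 * n := by
      have h2 : P.toFinset.card ≤ A.toFinset.card + B.toFinset.card := by
        have : P.toFinset = A.toFinset ∪ B.toFinset := by ext; simp [hPe]
        rw [this]
        exact Finset.card_union_le _ _
      have := hsmall A hA
      have := hsmall B hB
      nlinarith
    set R : Finset (Set V) := {Q | Q ∈ seq (j + 1) ∧ Q ≠ P ∧ ¬ G.Homog P Q}.toFinite.toFinset with hR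
    have hRc : R.card ≤ d := by
      have := hred P hP
      rw [SimpleGraph.redDegree, Set.ncard_eq_toFinset_card _ (Set.toFinite _)] at this
      exact this
    set U : Finset V := R.biUnion (fun Q => Q.toFinset) with hU
    have hUc : (d + 4) * U.card ≤ d * n := by
      have e1 : U.card ≤ ∑ Q ∈ R, Q.toFinset.card := Finset.card_biUnion_le
      have e2 : ∑ Q ∈ R, (d + 4) * Q.toFinset.card ≤ R.card * n := by
        rw [← smul_eq_mul]
        apply Finset.sum_le_card_nsmul
        intro Q hQ
        have hQ' : Q ∈ seq (j + 1) ∧ Q ≠ P ∧ ¬ G.Homog P Q := by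
          rw [hR, Set.Finite.mem_toFinset] at hQ
          exact hQ
        exact (hsmall Q (hsub Q hQ'.1 (hPe ▸ hQ'.2.1))).le
      rw [← Finset.mul_sum] at e2
      calc (d + 4) * U.card ≤ _ := Nat.mul_le_mul_left _ e1
        _ ≤ _ := e2
        _ ≤ _ := Nat.mul_le_mul_right _ hRc
    set X : Finset V := Finset.univ.filter (fun v => v ∉ P ∧ ∀ x ∈ P, G.Adj x v) with hX
    set Y : Finset V := Finset.univ.filter (fun v => v ∉ P ∧ ∀ x ∈ P, ¬ G.Adj x v) with hY
    have hall : (Finset.univ : Finset V) ⊆ (P.toFinset ∪ U) ∪ (X ∪ Y) := by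
      intro v _
      by_cases hvP : v ∈ P
      · simp [hvP]
      obtain ⟨Q, ⟨hQ, hvQ⟩, -⟩ := hcov v
      by_cases hh : G.Homog P Q
      · rcases hh with hh | hh
        · have : v ∈ X := by simp [hX, hvP]; exact fun x hx => hh x hx v hvQ
          simp [this]
        · have : v ∈ Y := by simp [hY, hvP]; exact fun x hx => hh x hx v hvQ
          simp [this]
      · have : v ∈ U := by
          rw [hU, Finset.mem_biUnion]
          refine ⟨Q, ?_, by simpa using hvQ⟩
          rw [hR, Set.Finite.mem_toFinset]
          exact ⟨hQ, fun h => hvP (h ▸ hvQ), hh⟩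
        simp [this]
    have hcard : n ≤ P.toFinset.card + U.card + (X.card + Y.card) := by
      calc n = (Finset.univ : Finset V).card := rfl
        _ ≤ _ := Finset.card_le_card hall
        _ ≤ _ := Finset.card_union_le _ _
        _ ≤ _ := Nat.add_le_add (Finset.card_union_le _ _) (Finset.card_union_le _ _)
    have hor : n ≤ (d + 4) * X.card ∨ n ≤ (d + 4) * Y.card := by
      by_contra! hc
      obtain ⟨c1, c2⟩ := hc
      have := Nat.mul_le_mul_left (d + 4) hcard
      nlinarith
    rcases hor with hc | hc
    · refine ⟨P.toFinset, X, ?_, conv _ hbig, conv _ hc, Or.inl ?_⟩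
      · rw [Finset.disjoint_left]
        intro a ha hb
        exact (Finset.mem_filter.1 hb).2.1 (by simpa using ha)
      · intro x hx y hy
        exact (Finset.mem_filter.1 hy).2.2 x (by simpa using hx)
    · refine ⟨P.toFinset, Y, ?_, conv _ hbig, conv _ hc, Or.inr ?_⟩
      · rw [Finset.disjoint_left]
        intro a ha hb
        exact (Finset.mem_filter.1 hb).2.1 (by simpa using ha)
      · intro x hx y hy
        exact (Finset.mem_filter.1 hy).2.2 x (by simpa using hx)
end

section
/- Every unit interval graph has twin-width at most 2. Precisely: let G be a finite simple graph for which there exists a map f from V(G) to the real numbers such that two distinct vertices u, v are adjacent in G if and only if |f(u) − f(v)| ≤ 1; then tww(G) ≤ 2. -/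
variable {V : Type*}

/-- The partition of `V` into the nonempty fibers of `g`. -/
def Fib {V α : Type*} (g : V → α) : Set (Set V) := Set.range (fun v => {w | g w = g v})

theorem fib_isVPartition {V α : Type*} (g : V → α) : IsVPartition (Fib g) := by
  constructor
  · rintro P ⟨v, rfl⟩
    exact ⟨v, rfl⟩
  · intro v
    refine ⟨{w | g w = g v}, ⟨⟨v, rfl⟩, rfl⟩, ?_⟩
    rintro Q ⟨⟨u, rfl⟩, hv⟩
    have hv' : g v = g u := hv
    ext w
    simp [hv']

theorem fib_congr {V α β : Type*} (g : V → α) (h : V → β)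
    (H : ∀ u v, g u = g v ↔ h u = h v) : Fib g = Fib h := by
  unfold Fib
  congr 1
  funext v
  ext w
  exact H w v

open Classical in
theorem fib_step {V α : Type*} (g : V → α) (a b : α) :
    Fib (fun u => if g u = a then b else g u) = Fib g ∨
      MergeStep (Fib g) (Fib (fun u => if g u = a then b else g u)) := by
  by_cases hab : a = b
  · left
    subst hab
    apply fib_congr
    intro u v
    grind
  by_cases ha : ∃ x, g x = a
  swap
  · left
    apply fib_congr
    intro u v
    grind
  by_cases hb : ∃ y, g y = b
  swap
  · left
    apply fib_congr
    intro u v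
    grind
  obtain ⟨x, hx⟩ := ha
  obtain ⟨y, hy⟩ := hb
  right
  refine ⟨{w | g w = a}, ⟨x, by simp [hx]⟩, {w | g w = b}, ⟨y, by simp [hy]⟩, ?_, ?_⟩
  · intro h
    have : x ∈ {w | g w = b} := h ▸ hx
    exact hab (hx.symm.trans this)
  · ext P
    constructor
    · rintro ⟨v, rfl⟩
      by_cases hv : g v = a ∨ g v = b
      · right
        ext w
        simp only [Set.mem_setOf_eq, Set.mem_union]
        grind
      · left
        refine ⟨⟨v, ?_⟩, ?_⟩
        · ext w
          simp only [Set.mem_setOf_eq]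
          grind
        · rintro (h | h)
          · have : v ∈ {w | g w = a} := h ▸ rfl
            exact hv (Or.inl this)
          · have : v ∈ {w | g w = b} := h ▸ rfl
            exact hv (Or.inr this)
    · rintro (⟨⟨v, rfl⟩, h⟩ | h)
      · have h1 : g v ≠ a := fun e => h (Or.inl (by simp [e]))
        have h2 : g v ≠ b := fun e => h (Or.inr (by simp [e]))
        refine ⟨v, ?_⟩
        ext w
        simp only [Set.mem_setOf_eq]
        grind
      · refine ⟨x, ?_⟩
        rw [Set.mem_singleton_iff.1 h]
        ext w
        simp only [Set.mem_setOf_eq, Set.mem_union]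
        grind

theorem fib_red {V α : Type*} [Finite V] (G : SimpleGraph V) (g : V → α)
    (H : ∀ v, ∃ a b, ∀ u, g u ≠ g v → g u ≠ a → g u ≠ b →
      (∀ x y, g x = g v → g y = g u → G.Adj x y) ∨
      (∀ x y, g x = g v → g y = g u → ¬ G.Adj x y)) :
    ∀ P ∈ Fib g, G.redDegree (Fib g) P ≤ 2 := by
  rintro P ⟨v, rfl⟩
  obtain ⟨a, b, h⟩ := H v
  unfold SimpleGraph.redDegree
  refine (Set.ncard_le_ncard (t := {{w | g w = a}, {w | g w = b}}) ?_ (Set.toFinite _)).trans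
    ((Set.ncard_insert_le _ _).trans (by rw [Set.ncard_singleton]))
  rintro Q ⟨⟨u, rfl⟩, hne, hh⟩
  by_contra hc
  simp only [Set.mem_insert_iff, Set.mem_singleton_iff, not_or] at hc
  have h1 : g u ≠ g v := fun e => hne (by simp [e])
  have h2 : g u ≠ a := fun e => hc.1 (by simp [e])
  have h3 : g u ≠ b := fun e => hc.2 (by simp [e])
  apply hh
  rcases h u h1 h2 h3 with h | h
  · exact Or.inl fun x hx y hy => h x y hx hy
  · exact Or.inr fun x hx y hy => h x y hx hy

theorem mergeStep_ncard {V : Type*} [Finite V] {C D : Set (Set V)} (hC : IsVPartition C)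
    (h : MergeStep C D) : D.ncard + 1 = C.ncard := by
  obtain ⟨A, hA, B, hB, hne, rfl⟩ := h
  have key : A ∪ B ∉ C \ {A, B} := by
    rintro ⟨h1, h2⟩
    obtain ⟨x, hx⟩ := hC.1 A hA
    apply h2
    left
    exact (hC.2 x).unique ⟨h1, Or.inl hx⟩ ⟨hA, hx⟩
  have hsub : ({A, B} : Set (Set V)) ⊆ C := by
    rintro X (rfl | rfl) <;> assumption
  have h1 := Set.ncard_diff_add_ncard_of_subset hsub (Set.toFinite C)
  rw [Set.ncard_pair hne] at h1
  rw [Set.union_singleton, Set.ncard_insert_of_notMem key (Set.toFinite _)]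
  omega

/-- Partition with red degree at most two. -/
def GoodP {V : Type*} (G : SimpleGraph V) (C : Set (Set V)) : Prop :=
  IsVPartition C ∧ ∀ P ∈ C, G.redDegree C P ≤ 2

theorem chain_seq {V : Type*} [Finite V] (G : SimpleGraph V) {C D : Set (Set V)}
    (h : Relation.ReflTransGen (fun C D => MergeStep C D ∧ GoodP G D) C D) (hC : GoodP G C) :
    ∃ (n : ℕ) (seq : ℕ → Set (Set V)), n + D.ncard = C.ncard ∧ seq 0 = C ∧ seq n = D ∧
      (∀ i < n, MergeStep (seq i) (seq (i + 1))) ∧ ∀ i ≤ n, GoodP G (seq i) := by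
  induction h using Relation.ReflTransGen.head_induction_on with
  | refl => exact ⟨0, fun _ => D, by simp, rfl, rfl, by simp, fun _ _ => hC⟩
  | @head A B hAB _ ih =>
    obtain ⟨n, s, h1, h2, h3, h4, h5⟩ := ih hAB.2
    refine ⟨n + 1, fun i => Nat.casesOn i A s, ?_, rfl, h3, ?_, ?_⟩
    · have := mergeStep_ncard hC.1 hAB.1
      omega
    · rintro (_ | i) hi
      · change MergeStep A (s 0)
        rw [h2]
        exact hAB.1
      · exact h4 i (by omega)
    · rintro (_ | i) hi
      · exact hC
      · exact h5 i (by omega)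

theorem fib_chain {V α : Type*} (G : SimpleGraph V) (g : V → α) (a b : α) (g' : V → α)
    {C : Set (Set V)}
    (h : Relation.ReflTransGen (fun C D => MergeStep C D ∧ GoodP G D) C (Fib g))
    (hg : ∀ u, (g u = a → g' u = b) ∧ (g u ≠ a → g' u = g u)) (hG : GoodP G (Fib g')) :
    Relation.ReflTransGen (fun C D => MergeStep C D ∧ GoodP G D) C (Fib g') := by
  classical
  have e : g' = fun u => if g u = a then b else g u := by
    funext u
    have := hg u
    grind
  subst e
  rcases fib_step g a b with h1 | h1
  · rw [h1]; exact h
  · exact h.tail ⟨h1, hG⟩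


theorem adj_same {V : Type*} (G : SimpleGraph V) (f : V → ℝ)
    (hf : ∀ u v : V, u ≠ v → (G.Adj u v ↔ |f u - f v| ≤ 1)) {u v : V} (hne : u ≠ v) (h : ⌊f u⌋ = ⌊f v⌋) : G.Adj u v := by
  rw [hf u v hne, abs_le]
  have h1 := Int.floor_add_fract (f u)
  have h2 := Int.floor_add_fract (f v)
  have h3 := Int.fract_nonneg (f u)
  have h4 := Int.fract_nonneg (f v)
  have h5 := Int.fract_lt_one (f u)
  have h6 := Int.fract_lt_one (f v)
  rw [h] at h1
  constructor <;> linarith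

theorem adj_succ {V : Type*} (G : SimpleGraph V) (f : V → ℝ)
    (hf : ∀ u v : V, u ≠ v → (G.Adj u v ↔ |f u - f v| ≤ 1)) {u v : V} (h : ⌊f v⌋ = ⌊f u⌋ + 1) :
    G.Adj u v ↔ Int.fract (f v) ≤ Int.fract (f u) := by
  have hne : u ≠ v := by rintro rfl; omega
  rw [hf u v hne, abs_le]
  have h1 := Int.floor_add_fract (f u)
  have h2 := Int.floor_add_fract (f v)
  have h3 := Int.fract_nonneg (f u)
  have h4 := Int.fract_nonneg (f v)
  have h5 := Int.fract_lt_one (f u)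
  have h6 := Int.fract_lt_one (f v)
  rw [h] at h2
  push_cast at h2
  constructor
  · rintro ⟨h7, h8⟩; linarith
  · intro h7; constructor <;> linarith

theorem not_adj_far {V : Type*} (G : SimpleGraph V) (f : V → ℝ)
    (hf : ∀ u v : V, u ≠ v → (G.Adj u v ↔ |f u - f v| ≤ 1)) {u v : V} (h : ⌊f u⌋ + 2 ≤ ⌊f v⌋) : ¬ G.Adj u v := by
  have hne : u ≠ v := by rintro rfl; omega
  rw [hf u v hne, abs_le]
  have h1 := Int.floor_add_fract (f u)
  have h2 := Int.floor_add_fract (f v)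
  have h4 := Int.fract_nonneg (f v)
  have h5 := Int.fract_lt_one (f u)
  have h7 : (⌊f u⌋ : ℝ) + 2 ≤ ⌊f v⌋ := by exact_mod_cast h
  rintro ⟨h8, h9⟩
  linarith

open Classical in
theorem good_one {V : Type*} (G : SimpleGraph V) (f : V → ℝ)
    (hf : ∀ u v : V, u ≠ v → (G.Adj u v ↔ |f u - f v| ≤ 1)) [Finite V] (S : Finset V)
    (hS : ∀ x ∈ S, ∀ y ∉ S, Int.fract (f x) < Int.fract (f y) ∨
      Int.fract (f x) = Int.fract (f y) ∧ ⌊f y⌋ ≤ ⌊f x⌋) :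
    GoodP G (Fib (fun v => if v ∈ S then (Sum.inl ⌊f v⌋ : ℤ ⊕ V) else Sum.inr v)) := by
  have mixed : ∀ v ∈ S, ∀ u ∉ S,
      (∀ x ∈ S, ⌊f x⌋ = ⌊f v⌋ → G.Adj x u) ∨ (∀ x ∈ S, ⌊f x⌋ = ⌊f v⌋ → ¬ G.Adj x u) := by
    intro v hv u hu
    rcases lt_trichotomy ⌊f u⌋ ⌊f v⌋ with h | h | h
    · by_cases h' : ⌊f v⌋ = ⌊f u⌋ + 1
      · left
        intro x hx hxv
        refine ((adj_succ G f hf (u := u) (v := x) (by omega)).2 ?_).symm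
        rcases hS x hx u hu with h1 | h1
        · exact h1.le
        · exact h1.1.le
      · right
        intro x hx hxv hadj
        exact not_adj_far G f hf (u := u) (v := x) (by omega) hadj.symm
    · left
      intro x hx hxv
      exact adj_same G f hf (by rintro rfl; exact hu hx) (by omega)
    · right
      intro x hx hxv
      by_cases h' : ⌊f u⌋ = ⌊f v⌋ + 1
      · rw [adj_succ G f hf (u := x) (v := u) (by omega), not_le]
        rcases hS x hx u hu with h1 | h1
        · exact h1
        · omega
      · exact not_adj_far G f hf (by omega)
  refine ⟨fib_isVPartition _, fib_red G _ ?_⟩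
  intro v
  refine ⟨Sum.inl (⌊f v⌋ - 1), Sum.inl (⌊f v⌋ + 1), ?_⟩
  intro u h1 h2 h3
  have aux : ∀ w, w ∈ S → ∀ x, (if x ∈ S then (Sum.inl ⌊f x⌋ : ℤ ⊕ V) else Sum.inr x) =
      Sum.inl ⌊f w⌋ → x ∈ S ∧ ⌊f x⌋ = ⌊f w⌋ := by
    intro w hw x hx
    split_ifs at hx with hxs
    exact ⟨hxs, Sum.inl.inj hx⟩
  have aux' : ∀ w, ∀ x, (if x ∈ S then (Sum.inl ⌊f x⌋ : ℤ ⊕ V) else Sum.inr x) =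
      Sum.inr w → x = w := by
    intro w x hx
    split_ifs at hx with hxs
    exact Sum.inr.inj hx
  by_cases hv : v ∈ S <;> by_cases hu : u ∈ S
  · simp only [hv, hu, if_true, ne_eq, Sum.inl.injEq] at h1 h2 h3 ⊢
    right
    intro x y hx hy hadj
    have hx' := (aux v hv x hx).2
    have hy' := (aux u hu y hy).2
    rcases lt_or_gt_of_ne h1 with h | h
    · exact not_adj_far G f hf (u := y) (v := x) (by omega) hadj.symm
    · exact not_adj_far G f hf (u := x) (v := y) (by omega) hadj
  · simp only [hv, hu, if_true, if_false]
    rcases mixed v hv u hu with h | h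
    · left
      intro x y hx hy
      rw [aux' u y hy]
      exact h x (aux v hv x hx).1 (aux v hv x hx).2
    · right
      intro x y hx hy
      rw [aux' u y hy]
      exact h x (aux v hv x hx).1 (aux v hv x hx).2
  · simp only [hv, hu, if_true, if_false]
    rcases mixed u hu v hv with h | h
    · left
      intro x y hx hy
      rw [aux' v x hx]
      exact (h y (aux u hu y hy).1 (aux u hu y hy).2).symm
    · right
      intro x y hx hy
      rw [aux' v x hx]
      exact fun hadj => h y (aux u hu y hy).1 (aux u hu y hy).2 hadj.symm
  · simp only [hv, hu, if_false]
    by_cases h : G.Adj v u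
    · left
      intro x y hx hy
      rwa [aux' v x hx, aux' u y hy]
    · right
      intro x y hx hy
      rwa [aux' v x hx, aux' u y hy]

theorem good_two {V : Type*} (G : SimpleGraph V) (f : V → ℝ)
    (hf : ∀ u v : V, u ≠ v → (G.Adj u v ↔ |f u - f v| ≤ 1)) [Finite V] (m : ℤ) : GoodP G (Fib (fun v => max ⌊f v⌋ m)) := by
  refine ⟨fib_isVPartition _, fib_red G _ ?_⟩
  intro v
  refine ⟨max ⌊f v⌋ m - 1, max ⌊f v⌋ m + 1, ?_⟩
  intro u h1 h2 h3
  right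
  intro x y hx hy hadj
  rcases lt_or_gt_of_ne h1 with h | h
  · exact not_adj_far G f hf (u := y) (v := x) (by omega) hadj.symm
  · exact not_adj_far G f hf (u := x) (v := y) (by omega) hadj

open Classical in
theorem phase_one {V : Type*} (G : SimpleGraph V) (f : V → ℝ)
    (hf : ∀ u v : V, u ≠ v → (G.Adj u v ↔ |f u - f v| ≤ 1)) [Fintype V] :
    ∀ n ≤ Fintype.card V, ∃ S : Finset V, S.card = n ∧
    (∀ x ∈ S, ∀ y ∉ S, Int.fract (f x) < Int.fract (f y) ∨
      Int.fract (f x) = Int.fract (f y) ∧ ⌊f y⌋ ≤ ⌊f x⌋) ∧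
    Relation.ReflTransGen (fun C D => MergeStep C D ∧ GoodP G D)
      (Set.range (fun v : V => ({v} : Set V)))
      (Fib (fun v => if v ∈ S then (Sum.inl ⌊f v⌋ : ℤ ⊕ V) else Sum.inr v)) := by
  intro n
  induction n with
  | zero =>
    intro _
    refine ⟨∅, rfl, by simp, ?_⟩
    have : Fib (fun v => if v ∈ (∅ : Finset V) then (Sum.inl ⌊f v⌋ : ℤ ⊕ V) else Sum.inr v) =
        Set.range (fun v : V => ({v} : Set V)) := by
      unfold Fib
      congr 1
      funext v
      ext w
      simp
    rw [this]
  | succ n ih =>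
    intro hn
    obtain ⟨S, hc, hS, hr⟩ := ih (by omega)
    have hne : (Sᶜ).Nonempty := by
      rw [← Finset.card_pos, Finset.card_compl]
      omega
    obtain ⟨v, hv, hmin⟩ := Finset.exists_min_image Sᶜ
      (fun v => toLex (Int.fract (f v), -⌊f v⌋)) hne
    rw [Finset.mem_compl] at hv
    have hS' : ∀ x ∈ insert v S, ∀ y ∉ insert v S, Int.fract (f x) < Int.fract (f y) ∨
        Int.fract (f x) = Int.fract (f y) ∧ ⌊f y⌋ ≤ ⌊f x⌋ := by
      intro x hx y hy
      rw [Finset.mem_insert] at hx hy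
      push Not at hy
      rcases hx with rfl | hx
      · have := hmin y (Finset.mem_compl.2 hy.2)
        rw [Prod.Lex.toLex_le_toLex] at this
        simpa using this
      · exact hS x hx y hy.2
    refine ⟨insert v S, by rw [Finset.card_insert_of_notMem hv, hc], hS', ?_⟩
    refine fib_chain G _ (Sum.inr v) (Sum.inl ⌊f v⌋) _ hr ?_ (good_one G f hf _ hS')
    intro u
    by_cases huv : u = v
    · subst huv
      simp [hv]
    · by_cases hu : u ∈ S <;> simp [huv, hu]

theorem phase_two {V : Type*} (G : SimpleGraph V) (f : V → ℝ)
    (hf : ∀ u v : V, u ≠ v → (G.Adj u v ↔ |f u - f v| ≤ 1)) [Finite V] (C : Set (Set V)) (m : ℤ)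
    (h : Relation.ReflTransGen (fun C D => MergeStep C D ∧ GoodP G D) C
      (Fib (fun v => max ⌊f v⌋ m))) (n : ℕ) :
    Relation.ReflTransGen (fun C D => MergeStep C D ∧ GoodP G D) C
      (Fib (fun v => max ⌊f v⌋ (m + n))) := by
  induction n with
  | zero => simpa using h
  | succ n ih =>
    refine fib_chain G _ (m + n) (m + (n + 1 : ℕ)) _ ih ?_ (good_two G f hf _)
    intro u
    push_cast
    constructor <;> intro _ <;> omega


/-- Every unit interval graph has twin-width at most 2: if there is a map
`f : V → ℝ` such that distinct vertices `u, v` are adjacent iff `|f u - f v| ≤ 1`,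
then `G` admits a 2-contraction sequence. -/
theorem stmt_7 {V : Type*} [Fintype V] [Nonempty V] (G : SimpleGraph V)
    (f : V → ℝ) (hf : ∀ u v : V, u ≠ v → (G.Adj u v ↔ |f u - f v| ≤ 1)) :
    TwwLe G 2 := by
  obtain ⟨S, hc, hS, hr⟩ := phase_one G f hf (Fintype.card V) le_rfl
  have hSu : S = Finset.univ := Finset.eq_univ_of_card S hc
  subst hSu
  obtain ⟨lo, hlo⟩ := (Set.finite_range (fun v => ⌊f v⌋)).bddBelow
  obtain ⟨hi, hhi⟩ := (Set.finite_range (fun v => ⌊f v⌋)).bddAbove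
  have hlo' : ∀ v, lo ≤ ⌊f v⌋ := fun v => hlo ⟨v, rfl⟩
  have hhi' : ∀ v, ⌊f v⌋ ≤ hi := fun v => hhi ⟨v, rfl⟩
  rw [fib_congr _ (fun v => max ⌊f v⌋ lo) (by intro u v; simp [hlo'])] at hr
  have h2 := phase_two G f hf _ lo hr (hi - lo).toNat
  obtain ⟨v₀⟩ := ‹Nonempty V›
  have e : Fib (fun v => max ⌊f v⌋ (lo + ((hi - lo).toNat : ℤ))) = {Set.univ} := by
    have e' : ∀ v, max ⌊f v⌋ (lo + ((hi - lo).toNat : ℤ)) = hi := by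
      intro v
      have := hlo' v
      have := hhi' v
      omega
    unfold Fib
    ext P
    simp only [e', Set.mem_range, Set.mem_singleton_iff, Set.setOf_true]
    exact ⟨fun ⟨_, h⟩ => h.symm, fun h => ⟨v₀, h.symm⟩⟩
  rw [e] at h2
  have e0 : Set.range (fun v : V => ({v} : Set V)) = Fib (fun v : V => v) := by
    unfold Fib
    rfl
  have g0 : GoodP G (Set.range (fun v : V => ({v} : Set V))) := by
    rw [e0]
    refine ⟨fib_isVPartition _, fib_red G _ ?_⟩
    intro v
    refine ⟨v, v, ?_⟩
    intro u _ _ _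
    by_cases h : G.Adj v u
    · left
      rintro x y rfl rfl
      exact h
    · right
      rintro x y rfl rfl
      exact h
  obtain ⟨n, s, hn, h0, h1, h3, h4⟩ := chain_seq G h2 g0
  have hcard : (Set.range (fun v : V => ({v} : Set V))).ncard = Fintype.card V := by
    rw [← Set.image_univ, Set.ncard_image_of_injective _ Set.singleton_injective, Set.ncard_univ,
      Nat.card_eq_fintype_card]
  rw [hcard, Set.ncard_singleton] at hn
  have hn' : Fintype.card V - 1 = n := by omega
  refine ⟨s, h0, ?_, ?_, ?_⟩
  · rw [hn']; exact h1
  · rw [hn']; exact h3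
  · rw [hn']; exact h4
end

section
/- For all positive integers k and m, the graph on vertex set {1, 2, ..., m} in which two distinct integers i and j are adjacent if and only if |i − j| ≤ k has twin-width at most 2. -/
variable {V : Type*}

namespace PathPow

/-- Same block of the interval partition of `Fin m` given by a set of cuts
(cut `p` separates `p` from `p + 1`). -/
def cls {m : ℕ} (S : Set ℕ) (v : Fin m) : Set (Fin m) :=
  {w | ∀ p ∈ S, p < (v : ℕ) ↔ p < (w : ℕ)}

def parts (m : ℕ) (S : Set ℕ) : Set (Set (Fin m)) := Set.range (cls S)

lemma mem_cls {m : ℕ} {S : Set ℕ} {v w : Fin m} :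
    w ∈ cls S v ↔ ∀ p ∈ S, p < (v : ℕ) ↔ p < (w : ℕ) := Iff.rfl

lemma self_mem {m : ℕ} (S : Set ℕ) (v : Fin m) : v ∈ cls S v := fun _ _ => Iff.rfl

lemma cls_eq {m : ℕ} {S : Set ℕ} {v w : Fin m} (h : w ∈ cls S v) : cls S w = cls S v := by
  ext x
  rw [mem_cls, mem_cls]
  constructor
  · intro h' p hp
    rw [h p hp, h' p hp]
  · intro h' p hp
    rw [← h p hp, h' p hp]

lemma isVPartition (m : ℕ) (S : Set ℕ) : IsVPartition (parts m S) := by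
  constructor
  · rintro _ ⟨v, rfl⟩
    exact ⟨v, self_mem S v⟩
  · intro v
    refine ⟨cls S v, ⟨⟨v, rfl⟩, self_mem S v⟩, ?_⟩
    rintro _ ⟨⟨w, rfl⟩, h⟩
    exact (cls_eq h).symm

lemma mergeStep (m : ℕ) (S : Set ℕ) (p : ℕ) (hp : p + 1 < m) (hpS : p ∈ S) :
    MergeStep (parts m S) (parts m (S \ {p})) := by
  set a : Fin m := ⟨p, by omega⟩ with ha
  set b : Fin m := ⟨p + 1, hp⟩ with hb
  have hab : cls S a ≠ cls S b := by
    intro h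
    have : b ∈ cls S a := h ▸ self_mem S b
    have := this p hpS
    simp [ha, hb] at this
  have key : cls (S \ {p}) a = cls S a ∪ cls S b := by
    ext x
    simp only [Set.mem_union, mem_cls, ha, hb]
    constructor
    · intro h
      by_cases hx : p < (x : ℕ)
      · right
        intro q hq
        by_cases hqp : q = p
        · subst hqp; omega
        · have := h q ⟨hq, hqp⟩
          omega
      · left
        intro q hq
        by_cases hqp : q = p
        · subst hqp; omega
        · exact h q ⟨hq, hqp⟩
    · rintro (h | h) q ⟨hq, hqp⟩
      · exact h q hq
      · have := h q hq
        have : q ≠ p := hqp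
        omega
  have key2 : ∀ v : Fin m, v ∉ cls (S \ {p}) a → cls (S \ {p}) v = cls S v := by
    intro v hv
    ext w
    constructor
    · intro h q hq
      by_cases hqp : q = p
      · subst hqp
        by_contra hcon
        apply hv
        rintro r ⟨hr, hrq⟩
        have h1 := h r ⟨hr, hrq⟩
        have h2 : r ≠ q := hrq
        simp only [ha]
        omega
      · exact h q ⟨hq, hqp⟩
    · intro h q hq
      exact h q hq.1
  refine ⟨cls S a, ⟨a, rfl⟩, cls S b, ⟨b, rfl⟩, hab, ?_⟩
  rw [← key]
  ext Q
  simp only [Set.mem_union, Set.mem_sdiff, Set.mem_insert_iff, Set.mem_singleton_iff, not_or]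
  constructor
  · rintro ⟨v, rfl⟩
    by_cases hv : v ∈ cls (S \ {p}) a
    · right; exact cls_eq hv
    · left
      rw [key2 v hv]
      refine ⟨⟨v, rfl⟩, ?_, ?_⟩
      · intro h
        apply hv
        rw [key, ← h]; exact Or.inl (self_mem S v)
      · intro h
        apply hv
        rw [key, ← h]; exact Or.inr (self_mem S v)
  · rintro (⟨⟨v, rfl⟩, h1, h2⟩ | rfl)
    · refine ⟨v, key2 v ?_⟩
      rw [key]
      rintro (h | h)
      · exact h1 (cls_eq h)
      · exact h2 (cls_eq h)
    · exact ⟨a, rfl⟩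

abbrev gr (k m : ℕ) : SimpleGraph (Fin m) := SimpleGraph.fromRel
      (fun i j : Fin m => |((i : ℕ) : ℤ) - ((j : ℕ) : ℤ)| ≤ (k : ℤ))

lemma gr_adj (k m : ℕ) (i j : Fin m) :
    (gr k m).Adj i j ↔ (i : ℕ) ≠ j ∧ (i : ℕ) ≤ j + k ∧ (j : ℕ) ≤ i + k := by
  simp only [gr, SimpleGraph.fromRel_adj, abs_le, ne_eq, Fin.ext_iff]
  omega

/-- Separated parts: existence of a cut. -/
lemma exists_cut {m : ℕ} {S : Set ℕ} {u v : Fin m} (h : cls S v ≠ cls S u) (huv : (u : ℕ) ≤ v) :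
    ∃ c ∈ S, (∀ x ∈ cls S u, (x : ℕ) ≤ c) ∧ (∀ y ∈ cls S v, c < (y : ℕ)) := by
  have h' : v ∉ cls S u := fun h' => h (cls_eq h')
  rw [mem_cls] at h'
  push Not at h'
  obtain ⟨c, hc, h'⟩ := h'
  refine ⟨c, hc, ?_, ?_⟩
  · intro x hx
    have := hx c hc
    omega
  · intro x hx
    have := hx c hc
    omega

lemma not_homog {k m : ℕ} {P Q : Set (Fin m)} (h : ¬ (gr k m).Homog P Q) :
    (∃ x ∈ P, ∃ y ∈ Q, (x : ℕ) ≤ y + k ∧ (y : ℕ) ≤ x + k) ∧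
    (∃ x ∈ P, ∃ y ∈ Q, (x : ℕ) = y ∨ (y : ℕ) + k < x ∨ (x : ℕ) + k < y) := by
  unfold SimpleGraph.Homog at h
  push Not at h
  obtain ⟨⟨x, hx, y, hy, h1⟩, ⟨x', hx', y', hy', h2⟩⟩ := h
  rw [gr_adj] at h1 h2
  exact ⟨⟨x', hx', y', hy', h2.2⟩, ⟨x, hx, y, hy, by omega⟩⟩

lemma redDegree_le (k m : ℕ) (S : Set ℕ)
    (hR : ∀ q c, q + 1 < m → q ∉ S → q + 1 ∉ S → q + k + 1 ∈ S → c ∈ S → q + 1 < c →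
      c < q + k + 1 → False)
    (hL : ∀ p, p + k + 2 ≤ m → p + k + 1 < m - 1 → p ∈ S → p + k + 1 ∉ S → False)
    (P : Set (Fin m)) (hP : P ∈ parts m S) : (gr k m).redDegree (parts m S) P ≤ 2 := by
  obtain ⟨u, rfl⟩ := hP
  have right : ∀ v1 v2 : Fin m, (u : ℕ) ≤ v1 → (v1 : ℕ) ≤ v2 → cls S v1 ≠ cls S u →
      ¬ (gr k m).Homog (cls S u) (cls S v1) → ¬ (gr k m).Homog (cls S u) (cls S v2) →
      cls S v1 = cls S v2 := by
    intro v1 v2 hu hv hne h1 h2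
    by_contra hcon
    obtain ⟨c, hc, hc1, hc2⟩ := exists_cut hne hu
    obtain ⟨d, hd, hd1, hd2⟩ := exists_cut (Ne.symm hcon) hv
    obtain ⟨_, x, hx, y, hy, hxy⟩ := not_homog h1
    obtain ⟨⟨x', hx', y', hy', hxy'⟩, _⟩ := not_homog h2
    have e1 := hc1 x hx
    have e2 := hc2 y hy
    have e3 := hd1 y hy
    have e4 := hd2 y' hy'
    have e5 := hc1 x' hx'
    have hno : ∀ q, (x : ℕ) ≤ q → q < (x' : ℕ) → q ∉ S := by
      intro q h1 h2 hq
      have := hx q hq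
      have := hx' q hq
      omega
    have := x'.2
    obtain ⟨q, rfl⟩ : ∃ q, d = q + k + 1 := ⟨d - (k + 1), by omega⟩
    exact hR q c (by omega) (hno _ (by omega) (by omega)) (hno _ (by omega) (by omega)) hd hc
      (by omega) (by omega)
  have left : ∀ v1 v2 : Fin m, (v2 : ℕ) ≤ u → (v1 : ℕ) ≤ v2 → cls S v2 ≠ cls S u →
      ¬ (gr k m).Homog (cls S u) (cls S v1) → ¬ (gr k m).Homog (cls S u) (cls S v2) →
      cls S v1 = cls S v2 := by
    intro v1 v2 hu hv hne h1 h2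
    by_contra hcon
    obtain ⟨c, hc, hc1, hc2⟩ := exists_cut (Ne.symm hne) hu
    obtain ⟨d, hd, hd1, hd2⟩ := exists_cut (Ne.symm hcon) hv
    obtain ⟨_, x, hx, y, hy, hxy⟩ := not_homog h2
    obtain ⟨⟨x', hx', y', hy', hxy'⟩, _⟩ := not_homog h1
    have e1 := hc1 y hy
    have e2 := hc2 x hx
    have e3 := hd1 y' hy'
    have e4 := hd2 y hy
    have e5 := hc2 x' hx'
    have hno : ∀ q, (x' : ℕ) ≤ q → q < (x : ℕ) → q ∉ S := by
      intro q h1 h2 hq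
      have := hx q hq
      have := hx' q hq
      omega
    have := x.2
    exact hL d (by omega) (by omega) hd (hno _ (by omega) (by omega))
  set A : Set (Set (Fin m)) := {Q | ∃ v : Fin m, (u : ℕ) ≤ v ∧ Q = cls S v ∧ Q ≠ cls S u ∧
    ¬ (gr k m).Homog (cls S u) Q} with hA
  set B : Set (Set (Fin m)) := {Q | ∃ v : Fin m, (v : ℕ) ≤ u ∧ Q = cls S v ∧ Q ≠ cls S u ∧
    ¬ (gr k m).Homog (cls S u) Q} with hB
  have hAs : A.Subsingleton := by
    rintro _ ⟨v1, h1, rfl, h2, h3⟩ _ ⟨v2, h4, rfl, h5, h6⟩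
    rcases le_total (v1 : ℕ) v2 with h | h
    · exact right v1 v2 h1 h h2 h3 h6
    · exact (right v2 v1 h4 h h5 h6 h3).symm
  have hBs : B.Subsingleton := by
    rintro _ ⟨v1, h1, rfl, h2, h3⟩ _ ⟨v2, h4, rfl, h5, h6⟩
    rcases le_total (v1 : ℕ) v2 with h | h
    · exact left v1 v2 h4 h h5 h3 h6
    · exact (left v2 v1 h1 h h2 h6 h3).symm
  have hsub : {Q | Q ∈ parts m S ∧ Q ≠ cls S u ∧ ¬ (gr k m).Homog (cls S u) Q} ⊆ A ∪ B := by
    rintro _ ⟨⟨v, rfl⟩, h1, h2⟩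
    rcases le_total (u : ℕ) v with h | h
    · exact Or.inl ⟨v, h, rfl, h1, h2⟩
    · exact Or.inr ⟨v, h, rfl, h1, h2⟩
  have c1 : A.ncard ≤ 1 := Set.ncard_le_one_iff_subsingleton.mpr hAs
  have c2 : B.ncard ≤ 1 := Set.ncard_le_one_iff_subsingleton.mpr hBs
  calc (gr k m).redDegree (parts m S) (cls S u) ≤ (A ∪ B).ncard :=
        Set.ncard_le_ncard hsub (Set.toFinite _)
    _ ≤ A.ncard + B.ncard := Set.ncard_union_le A B
    _ ≤ 2 := by omega

/-- The priority of a cut: smaller keys are removed first. -/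
def key (k m p : ℕ) : ℕ := (p % (k + 1)) * m + p

def rank (k m p : ℕ) : ℕ := ((Finset.range (m - 1)).filter (fun q => key k m q < key k m p)).card

lemma key_lt {k m p q : ℕ} (hp : p < m) (h : p % (k + 1) < q % (k + 1)) :
    key k m p < key k m q := by
  unfold key
  have : (p % (k + 1) + 1) * m ≤ (q % (k + 1)) * m := Nat.mul_le_mul_right _ h
  rw [add_mul] at this
  omega

lemma key_inj {k m p q : ℕ} (hp : p < m) (hq : q < m) (h : key k m p = key k m q) : p = q := by
  rcases lt_trichotomy (p % (k + 1)) (q % (k + 1)) with h1 | h1 | h1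
  · have := key_lt (m := m) hp h1; omega
  · unfold key at h
    rw [h1] at h; omega
  · have := key_lt (m := m) hq h1; omega

lemma rank_lt {k m p q : ℕ} (hp : p < m - 1) (h : key k m p < key k m q) :
    rank k m p < rank k m q := by
  apply Finset.card_lt_card
  rw [Finset.ssubset_iff_of_subset]
  · exact ⟨p, by simp [hp, h], by simp⟩
  · intro r hr
    simp only [Finset.mem_filter] at hr ⊢
    exact ⟨hr.1, hr.2.trans h⟩

lemma key_lt_of_rank_lt {k m p q : ℕ} (hp : p < m - 1) (hq : q < m - 1)
    (h : rank k m p < rank k m q) : key k m p < key k m q := by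
  rcases lt_trichotomy (key k m p) (key k m q) with h1 | h1 | h1
  · exact h1
  · have := key_inj (by omega) (by omega) h1
    subst this; omega
  · have := rank_lt hq h1; omega

lemma rank_bound {k m p : ℕ} (hp : p < m - 1) : rank k m p < m - 1 := by
  have : rank k m p < (Finset.range (m - 1)).card := by
    apply Finset.card_lt_card
    rw [Finset.ssubset_iff_of_subset (Finset.filter_subset _ _)]
    exact ⟨p, by simp [hp], by simp⟩
  simpa using this

lemma rank_inj {k m p q : ℕ} (hp : p < m - 1) (hq : q < m - 1)
    (h : rank k m p = rank k m q) : p = q := by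
  rcases lt_trichotomy (key k m p) (key k m q) with h1 | h1 | h1
  · have := rank_lt hp h1; omega
  · exact key_inj (by omega) (by omega) h1
  · have := rank_lt hq h1; omega

lemma rank_surj {k m i : ℕ} (hi : i < m - 1) : ∃ p < m - 1, rank k m p = i := by
  have hinj : Set.InjOn (rank k m) (Finset.range (m - 1)) := by
    intro p hp q hq h
    exact rank_inj (by simpa using hp) (by simpa using hq) h
  have himg : (Finset.range (m - 1)).image (rank k m) = Finset.range (m - 1) := by
    apply Finset.eq_of_subset_of_card_le
    · intro x hx
      obtain ⟨p, hp, rfl⟩ := Finset.mem_image.mp hx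
      exact Finset.mem_range.mpr (rank_bound (Finset.mem_range.mp hp))
    · rw [Finset.card_image_of_injOn hinj]
  have : i ∈ (Finset.range (m - 1)).image (rank k m) := by rw [himg]; simpa using hi
  obtain ⟨p, hp, h⟩ := Finset.mem_image.mp this
  exact ⟨p, Finset.mem_range.mp hp, h⟩

/-- Remaining cuts at time `i`. -/
def cuts (k m i : ℕ) : Set ℕ := {p | p < m - 1 ∧ i ≤ rank k m p}

lemma key_cmp {k m i p q : ℕ} (hq : q < m - 1) (hp : p ∈ cuts k m i)
    (hq' : q ∉ cuts k m i) : key k m q < key k m p := by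
  apply key_lt_of_rank_lt hq hp.1
  have h1 : ¬ (q < m - 1 ∧ i ≤ rank k m q) := hq'
  have h2 := hp.2
  omega

lemma condL (k m i p : ℕ) (h : p + k + 2 ≤ m) (hp : p ∈ cuts k m i)
    (hq : p + k + 1 ∉ cuts k m i) (hlt : p + k + 1 < m - 1) : False := by
  have := key_cmp hlt hp hq
  unfold key at this
  rw [add_assoc, Nat.add_mod_right] at this
  omega

lemma condR (k m i q c : ℕ) (hq : q ∉ cuts k m i) (hq1 : q + 1 ∉ cuts k m i)
    (hp : q + k + 1 ∈ cuts k m i) (hc : c ∈ cuts k m i) (h1 : q + 1 < c)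
    (h2 : c < q + k + 1) : False := by
  have hc1 : c < m - 1 := hc.1
  have hp1 : q + k + 1 < m - 1 := hp.1
  have a1 := key_cmp (by omega) hc hq
  have a2 := key_cmp (by omega) hp hq1
  have hmod : (q + k + 1) % (k + 1) = q % (k + 1) := by rw [add_assoc, Nat.add_mod_right]
  have hlt : q % (k + 1) < k + 1 := Nat.mod_lt _ (by omega)
  have hlc : c % (k + 1) < k + 1 := Nat.mod_lt _ (by omega)
  by_cases hr : q % (k + 1) = k
  · by_cases hcr : c % (k + 1) = k
    · have : k + 1 ∣ c - q := (Nat.modEq_iff_dvd' (by omega)).mp (hr.trans hcr.symm)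
      have := Nat.le_of_dvd (by omega) this
      omega
    · have := key_lt (k := k) (m := m) (p := c) (q := q) (by omega) (by omega)
      omega
  · have h3 : (q + 1) % (k + 1) = q % (k + 1) + 1 := by
      rw [Nat.add_mod, Nat.mod_eq_of_lt (a := 1) (by omega), Nat.mod_eq_of_lt (by omega)]
    have := key_lt (k := k) (m := m) (p := q + k + 1) (q := q + 1) (by omega) (by omega)
    omega

end PathPow

/-- For positive `k` and `m`, the graph on `{1, …, m}` (modelled as `Fin m`) where
two distinct integers are adjacent iff they differ by at most `k` has twin-width
at most 2. -/
theorem stmt_8 (k m : ℕ) (hk : 0 < k) (hm : 0 < m) :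
    TwwLe (SimpleGraph.fromRel
      (fun i j : Fin m => |((i : ℕ) : ℤ) - ((j : ℕ) : ℤ)| ≤ (k : ℤ))) 2 := by
  refine ⟨fun i => PathPow.parts m (PathPow.cuts k m i), ?_, ?_, ?_, ?_⟩
  · have h0 : ∀ v : Fin m, PathPow.cls (PathPow.cuts k m 0) v = {v} := by
      intro v
      ext w
      rw [PathPow.mem_cls, Set.mem_singleton_iff]
      constructor
      · intro h
        have hv := v.2
        have hw := w.2
        rcases lt_trichotomy (v : ℕ) w with h1 | h1 | h1
        · have := h v ⟨by omega, Nat.zero_le _⟩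
          omega
        · exact Fin.ext h1.symm
        · have := h w ⟨by omega, Nat.zero_le _⟩
          omega
      · rintro rfl p _
        exact Iff.rfl
    change Set.range _ = _
    congr 1
    funext v
    exact h0 v
  · have h0 : ∀ v : Fin m, PathPow.cls (PathPow.cuts k m (m - 1)) v = Set.univ := by
      intro v
      ext w
      rw [PathPow.mem_cls]
      refine ⟨fun _ => trivial, fun _ p hp => ?_⟩
      have h1 := PathPow.rank_bound (k := k) hp.1
      have h2 := hp.2
      omega
    rw [Fintype.card_fin]
    ext Q
    simp only [Set.mem_singleton_iff]
    constructor
    · rintro ⟨v, rfl⟩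
      exact h0 v
    · rintro rfl
      exact ⟨⟨0, hm⟩, h0 _⟩
  · intro i hi
    rw [Fintype.card_fin] at hi
    obtain ⟨p, hp, hpi⟩ := PathPow.rank_surj (k := k) hi
    have hS : PathPow.cuts k m (i + 1) = PathPow.cuts k m i \ {p} := by
      ext q
      simp only [PathPow.cuts, Set.mem_ofPred_eq, Set.mem_sdiff, Set.mem_singleton_iff]
      constructor
      · rintro ⟨h1, h2⟩
        refine ⟨⟨h1, by omega⟩, ?_⟩
        rintro rfl
        omega
      · rintro ⟨⟨h1, h2⟩, h3⟩
        refine ⟨h1, ?_⟩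
        rcases Nat.lt_or_ge i (PathPow.rank k m q) with h | h
        · exact h
        · exact absurd (PathPow.rank_inj (k := k) h1 hp (by omega)) h3
    change MergeStep _ (PathPow.parts m (PathPow.cuts k m (i + 1)))
    rw [hS]
    exact PathPow.mergeStep m _ p (by omega) ⟨hp, hpi.ge⟩
  · intro i _
    refine ⟨PathPow.isVPartition m _, fun P hP => PathPow.redDegree_le k m _ ?_ ?_ P hP⟩
    · intro q c _ h1 h2 h3 h4 h5 h6
      exact PathPow.condR k m i q c h1 h2 h3 h4 h5 h6
    · intro p h1 h2 h3 h4
      exact PathPow.condL k m i p h1 h3 h4 h2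
end

section
/- Every finite simple graph G on n ≥ 1 vertices of twin-width at most d admits an interval biclique partition of size at most (d+1)(n−1): there exist a bijection σ from V(G) to {1, ..., n} and a family of at most (d+1)(n−1) pairs (A_i, B_i) of disjoint vertex subsets such that each σ(A_i) and each σ(B_i) is a set of consecutive integers, every vertex of A_i is adjacent in G to every vertex of B_i, and every edge of G has its endpoints in A_i and B_i respectively for exactly one index i. -/
variable {V : Type*}

namespace IBP

def Full (G : SimpleGraph V) (P Q : Set V) : Prop := ∀ x ∈ P, ∀ y ∈ Q, G.Adj x y

def Black (G : SimpleGraph V) (C : Set (Set V)) (u v : V) : Prop :=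
  ∃ P ∈ C, ∃ Q ∈ C, P ≠ Q ∧ u ∈ P ∧ v ∈ Q ∧ Full G P Q

def Cov (p : Set V × Set V) (u v : V) : Prop :=
  (u ∈ p.1 ∧ v ∈ p.2) ∨ (u ∈ p.2 ∧ v ∈ p.1)

theorem Full.symm {G : SimpleGraph V} {P Q : Set V} (h : Full G P Q) : Full G Q P :=
  fun x hx y hy => (h y hy x hx).symm

theorem Black.symm {G : SimpleGraph V} {C : Set (Set V)} {u v : V} (h : Black G C u v) :
    Black G C v u := by
  obtain ⟨P, hP, Q, hQ, hne, hu, hv, hf⟩ := h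
  exact ⟨Q, hQ, P, hP, hne.symm, hv, hu, hf.symm⟩

theorem puniq {C : Set (Set V)} (h : IsVPartition C) {P Q : Set V} (hP : P ∈ C) (hQ : Q ∈ C)
    {v : V} (hv : v ∈ P) (hv' : v ∈ Q) : P = Q :=
  (h.2 v).unique ⟨hP, hv⟩ ⟨hQ, hv'⟩

theorem pdisj {C : Set (Set V)} (h : IsVPartition C) {P Q : Set V} (hP : P ∈ C) (hQ : Q ∈ C)
    (hne : P ≠ Q) : Disjoint P Q :=
  Set.disjoint_left.2 fun _ hx hy => hne (puniq h hP hQ hx hy)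

/-- the bicliques created by one contraction -/
def newB (G : SimpleGraph V) (C : Set (Set V)) (A B : Set V) : Set (Set V × Set V) :=
  {p | (p.1 = A ∨ p.1 = B) ∧ p.2 ∈ C ∧ p.2 ≠ A ∧ p.2 ≠ B ∧ Full G p.1 p.2 ∧
    ¬ Full G (A ∪ B) p.2} ∪ {p | p = (A, B) ∧ Full G A B}

theorem step_lemma [Finite V] (G : SimpleGraph V) (d : ℕ) (C D : Set (Set V))
    (hC : IsVPartition C) (hD : IsVPartition D) (hm : MergeStep C D)
    (hred : ∀ P ∈ D, G.redDegree D P ≤ d) :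
    ∃ T : Set (Set V × Set V), T.ncard ≤ d + 1 ∧
      (∀ p ∈ T, p.1 ∈ C ∧ p.2 ∈ C ∧ Disjoint p.1 p.2 ∧ Full G p.1 p.2) ∧
      (∀ u v, Black G D u v → Black G C u v) ∧
      (∀ u v, ∀ p ∈ T, Cov p u v → Black G C u v ∧ ¬ Black G D u v) ∧
      (∀ u v, Black G C u v → ¬ Black G D u v → ∃! p, p ∈ T ∧ Cov p u v) := by
  obtain ⟨A, hA, B, hB, hAB, rfl⟩ := hm
  have hABD : A ∪ B ∈ (C \ {A, B}) ∪ {A ∪ B} := Or.inr rfl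
  have hold : ∀ Q ∈ C, Q ≠ A → Q ≠ B → Q ∈ (C \ {A, B}) ∪ {A ∪ B} := by
    intro Q hQ h1 h2
    left; simp [hQ, h1, h2]
  have hnew : ∀ Q ∈ C, Q ≠ A → Q ≠ B → Q ≠ A ∪ B := by
    intro Q hQ h1 h2 h
    obtain ⟨a, ha⟩ := hC.1 A hA
    exact h1 (puniq hC hQ hA (h ▸ Or.inl ha) ha)
  have hprop : ∀ p ∈ newB G C A B,
      p.1 ∈ C ∧ p.2 ∈ C ∧ p.1 ≠ p.2 ∧ Full G p.1 p.2 := by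
    rintro ⟨P, Q⟩ (⟨h1 | h1, h2, h3, h4, h5, h6⟩ | ⟨h, h'⟩)
    · simp only at *; subst h1; exact ⟨hA, h2, h3.symm, h5⟩
    · simp only at *; subst h1; exact ⟨hB, h2, h4.symm, h5⟩
    · simp only [Prod.mk.injEq] at h; obtain ⟨rfl, rfl⟩ := h; exact ⟨hA, hB, hAB, h'⟩
  have hnb : ∀ u v, ∀ p ∈ newB G C A B, u ∈ p.1 → v ∈ p.2 →
      ¬ Black G ((C \ {A, B}) ∪ {A ∪ B}) u v := by
    rintro u v ⟨P, Q⟩ hp hu hv ⟨P', hP', Q', hQ', hne, hu', hv', hf⟩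
    simp only at hu hv
    rcases hp with ⟨h1, h2, h3, h4, h5, h6⟩ | ⟨h, h'⟩
    · simp only at h1 h2 h3 h4 h5 h6
      have huAB : u ∈ A ∪ B := by
        rcases h1 with rfl | rfl
        · exact Or.inl hu
        · exact Or.inr hu
      have e1 := puniq hD hP' hABD hu' huAB
      have e2 := puniq hD hQ' (hold Q h2 h3 h4) hv' hv
      subst e1 e2
      exact h6 hf
    · simp only [Prod.mk.injEq] at h; obtain ⟨rfl, rfl⟩ := h
      exact hne ((puniq hD hP' hABD hu' (Or.inl hu)).trans
        (puniq hD hQ' hABD hv' (Or.inr hv)).symm)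
  refine ⟨newB G C A B, ?_, ?_, ?_, ?_, ?_⟩
  · unfold newB
    refine (Set.ncard_union_le _ _).trans (add_le_add ?_ ?_)
    · refine le_trans ?_ (hred _ hABD)
      unfold SimpleGraph.redDegree
      refine Set.ncard_le_ncard_of_injOn Prod.snd ?_ ?_ (Set.toFinite _)
      · rintro ⟨P, Q⟩ ⟨h1, h2, h3, h4, h5, h6⟩
        simp only at h1 h2 h3 h4 h5 h6
        refine ⟨hold Q h2 h3 h4, hnew Q h2 h3 h4, ?_⟩
        rintro (h | h)
        · exact h6 h
        · obtain ⟨q, hq⟩ := hC.1 Q h2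
          rcases h1 with rfl | rfl
          · obtain ⟨a, ha⟩ := hC.1 _ hA
            exact h a (Or.inl ha) q hq (h5 a ha q hq)
          · obtain ⟨a, ha⟩ := hC.1 _ hB
            exact h a (Or.inr ha) q hq (h5 a ha q hq)
      · rintro ⟨P, Q⟩ ⟨h1, h2, h3, h4, h5, h6⟩ ⟨P', Q'⟩ ⟨h1', h2', h3', h4', h5', h6'⟩ e
        simp only at h1 h2 h3 h4 h5 h6 h1' h2' h3' h4' h5' h6' e
        subst e
        have : P = P' := by
          rcases h1 with rfl | rfl <;> rcases h1' with rfl | rfl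
          · rfl
          · exact (h6 (fun x hx y hy => hx.elim (fun h => h5 x h y hy)
              (fun h => h5' x h y hy))).elim
          · exact (h6 (fun x hx y hy => hx.elim (fun h => h5' x h y hy)
              (fun h => h5 x h y hy))).elim
          · rfl
        rw [this]
    · refine (Set.ncard_le_ncard (t := {(A, B)}) ?_ (Set.toFinite _)).trans ?_
      · rintro p ⟨h, _⟩; exact h
      · simp
  · intro p hp
    obtain ⟨h1, h2, h3, h4⟩ := hprop p hp
    exact ⟨h1, h2, pdisj hC h1 h2 h3, h4⟩
  · rintro u v ⟨P, hP, Q, hQ, hne, hu, hv, hf⟩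
    obtain ⟨P', ⟨hP', hu'⟩, -⟩ := hC.2 u
    obtain ⟨Q', ⟨hQ', hv'⟩, -⟩ := hC.2 v
    have hsub : ∀ R ∈ (C \ {A, B}) ∪ {A ∪ B}, ∀ R' ∈ C, ∀ w, w ∈ R → w ∈ R' → R' ⊆ R := by
      rintro R (hR | hR) R' hR' w hw hw'
      · rw [puniq hC hR.1 hR' hw hw']
      · rw [Set.mem_singleton_iff] at hR
        subst hR
        rcases hw with hw | hw
        · rw [puniq hC hR' hA hw' hw]; exact Set.subset_union_left
        · rw [puniq hC hR' hB hw' hw]; exact Set.subset_union_right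
    have s1 := hsub P hP P' hP' u hu hu'
    have s2 := hsub Q hQ Q' hQ' v hv hv'
    refine ⟨P', hP', Q', hQ', ?_, hu', hv', fun x hx y hy => hf x (s1 hx) y (s2 hy)⟩
    rintro rfl
    exact hne (puniq hD hP hQ hu (s2 hu'))
  · rintro u v p hp (⟨hu, hv⟩ | ⟨hu, hv⟩)
    · obtain ⟨h1, h2, h3, h4⟩ := hprop p hp
      exact ⟨⟨p.1, h1, p.2, h2, h3, hu, hv, h4⟩, hnb u v p hp hu hv⟩
    · obtain ⟨h1, h2, h3, h4⟩ := hprop p hp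
      exact ⟨⟨p.2, h2, p.1, h1, h3.symm, hu, hv, h4.symm⟩,
        fun h => hnb v u p hp hv hu h.symm⟩
  · rintro u v ⟨P, hP, Q, hQ, hne, hu, hv, hf⟩ hnD
    have hex : ∃ p, p ∈ newB G C A B ∧ (p = (P, Q) ∨ p = (Q, P)) := by
      by_cases hPA : P = A ∨ P = B
      · by_cases hQA : Q = A ∨ Q = B
        · refine ⟨(A, B), Or.inr ⟨rfl, ?_⟩, ?_⟩
          · rcases hPA with rfl | rfl <;> rcases hQA with rfl | rfl
            · exact (hne rfl).elim
            · exact hf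
            · exact hf.symm
            · exact (hne rfl).elim
          · rcases hPA with rfl | rfl <;> rcases hQA with rfl | rfl <;> simp_all
        · push Not at hQA
          refine ⟨(P, Q), Or.inl ⟨hPA, hQ, hQA.1, hQA.2, hf, fun h => hnD ?_⟩, Or.inl rfl⟩
          refine ⟨A ∪ B, hABD, Q, hold Q hQ hQA.1 hQA.2, (hnew Q hQ hQA.1 hQA.2).symm, ?_, hv, h⟩
          rcases hPA with rfl | rfl
          · exact Or.inl hu
          · exact Or.inr hu
      · push Not at hPA
        by_cases hQA : Q = A ∨ Q = B
        · refine ⟨(Q, P), Or.inl ⟨hQA, hP, hPA.1, hPA.2, hf.symm, fun h => hnD ?_⟩, Or.inr rfl⟩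
          refine ⟨P, hold P hP hPA.1 hPA.2, A ∪ B, hABD, (hnew P hP hPA.1 hPA.2), hu, ?_, h.symm⟩
          rcases hQA with rfl | rfl
          · exact Or.inl hv
          · exact Or.inr hv
        · push Not at hQA
          exact (hnD ⟨P, hold P hP hPA.1 hPA.2, Q, hold Q hQ hQA.1 hQA.2, hne, hu, hv, hf⟩).elim
    have hcase : ∀ p, p ∈ newB G C A B → Cov p u v → p = (P, Q) ∨ p = (Q, P) := by
      rintro ⟨X, Y⟩ hp (⟨h1, h2⟩ | ⟨h1, h2⟩)
      · obtain ⟨g1, g2, -, -⟩ := hprop _ hp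
        left; rw [puniq hC hP g1 hu h1, puniq hC hQ g2 hv h2]
      · obtain ⟨g1, g2, -, -⟩ := hprop _ hp
        right; rw [puniq hC hP g2 hu h1, puniq hC hQ g1 hv h2]
    have hswap : ∀ X Y, (X, Y) ∈ newB G C A B → (Y, X) ∈ newB G C A B → False := by
      rintro X Y (⟨h1, h2, h3, h4, -, -⟩ | ⟨h, -⟩) (⟨h1', h2', h3', h4', -, -⟩ | ⟨h', -⟩)
      · exact h1'.elim h3 h4
      · simp only [Prod.mk.injEq] at h'; exact h3 h'.1
      · simp only [Prod.mk.injEq] at h; exact h3' h.1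
      · simp only [Prod.mk.injEq] at h h'; exact hAB (h.1.symm.trans h'.2)
    obtain ⟨p, hp, hpe⟩ := hex
    refine ⟨p, ⟨hp, ?_⟩, ?_⟩
    · rcases hpe with rfl | rfl
      · exact Or.inl ⟨hu, hv⟩
      · exact Or.inr ⟨hu, hv⟩
    · rintro q ⟨hq, hqc⟩
      rcases hcase q hq hqc with rfl | rfl <;> rcases hpe with rfl | rfl
      · rfl
      · exact (hswap _ _ hp hq).elim
      · exact (hswap _ _ hp hq).elim
      · rfl

theorem bicliques [Fintype V] (G : SimpleGraph V) (d N : ℕ) (seq : ℕ → Set (Set V))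
    (h0 : seq 0 = Set.range (fun v : V => ({v} : Set V)))
    (hm : ∀ i < N, MergeStep (seq i) (seq (i + 1)))
    (hp : ∀ i ≤ N, IsVPartition (seq i) ∧ ∀ P ∈ seq i, G.redDegree (seq i) P ≤ d) :
    ∀ i ≤ N, ∃ S : Set (Set V × Set V), S.ncard ≤ (d + 1) * i ∧
      (∀ p ∈ S, (∃ j ≤ i, p.1 ∈ seq j) ∧ (∃ j ≤ i, p.2 ∈ seq j) ∧ Disjoint p.1 p.2 ∧
        Full G p.1 p.2) ∧
      (∀ u v, G.Adj u v → ∀ p ∈ S, Cov p u v → ¬ Black G (seq i) u v) ∧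
      (∀ u v, G.Adj u v → ¬ Black G (seq i) u v → ∃! p, p ∈ S ∧ Cov p u v) := by
  intro i
  induction i with
  | zero =>
    intro _
    refine ⟨∅, by simp, by simp, by simp, ?_⟩
    intro u v huv hn
    refine (hn ⟨{u}, ?_, {v}, ?_, ?_, rfl, rfl, ?_⟩).elim
    · rw [h0]; exact ⟨u, rfl⟩
    · rw [h0]; exact ⟨v, rfl⟩
    · intro h; exact huv.ne (Set.singleton_injective h)
    · rintro x rfl y rfl; exact huv
  | succ i ih =>
    intro hi
    obtain ⟨S, hS1, hS2, hS3, hS4⟩ := ih (by omega)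
    obtain ⟨T, hT1, hT2, hT3, hT4, hT5⟩ := step_lemma G d (seq i) (seq (i+1)) (hp i (by omega)).1
      (hp (i+1) hi).1 (hm i (by omega)) (hp (i+1) hi).2
    refine ⟨S ∪ T, ?_, ?_, ?_, ?_⟩
    · refine (Set.ncard_union_le _ _).trans ?_
      rw [mul_add, mul_one]; omega
    · rintro p (h | h)
      · obtain ⟨⟨j, hj, h1⟩, ⟨k, hk, h2⟩, h3⟩ := hS2 p h
        exact ⟨⟨j, by omega, h1⟩, ⟨k, by omega, h2⟩, h3⟩
      · obtain ⟨h1, h2, h3⟩ := hT2 p h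
        exact ⟨⟨i, by omega, h1⟩, ⟨i, by omega, h2⟩, h3⟩
    · rintro u v huv p (h | h) hc hb
      · exact hS3 u v huv p h hc (hT3 u v hb)
      · exact (hT4 u v p h hc).2 hb
    · intro u v huv hn
      by_cases hb : Black G (seq i) u v
      · obtain ⟨p, ⟨h1, h2⟩, h3⟩ := hT5 u v hb hn
        refine ⟨p, ⟨Or.inr h1, h2⟩, ?_⟩
        rintro q ⟨hq | hq, hqc⟩
        · exact (hS3 u v huv q hq hqc hb).elim
        · exact h3 q ⟨hq, hqc⟩
      · obtain ⟨p, ⟨h1, h2⟩, h3⟩ := hS4 u v huv hb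
        refine ⟨p, ⟨Or.inl h1, h2⟩, ?_⟩
        rintro q ⟨hq | hq, hqc⟩
        · exact h3 q ⟨hq, hqc⟩
        · exact (hb (hT4 u v q hq hqc).1).elim

open Classical in
theorem ordering (N : ℕ) (seq : ℕ → Set (Set V))
    (h0 : seq 0 = Set.range (fun v : V => ({v} : Set V)))
    (hm : ∀ i < N, MergeStep (seq i) (seq (i + 1)))
    (hp : ∀ i ≤ N, IsVPartition (seq i)) :
    ∀ i ≤ N, ∃ L : Set V → List V,
      (∀ P ∈ seq i, (L P).Nodup ∧ ∀ v, v ∈ L P ↔ v ∈ P) ∧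
      ∀ j ≤ i, ∀ Q ∈ seq j, ∃ P ∈ seq i, ∃ m, m <:+: L P ∧ ∀ v, v ∈ m ↔ v ∈ Q := by
  intro i
  induction i with
  | zero =>
    intro _
    have key : ∀ P ∈ seq 0, ∃ l : List V, l.Nodup ∧ ∀ v, v ∈ l ↔ v ∈ P := by
      rw [h0]
      rintro _ ⟨v, rfl⟩
      exact ⟨[v], by simp, by simp⟩
    choose! L hL using key
    refine ⟨L, hL, ?_⟩
    intro j hj Q hQ
    obtain rfl : j = 0 := by omega
    exact ⟨Q, hQ, L Q, List.infix_rfl, (hL Q hQ).2⟩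
  | succ i ih =>
    intro hi
    obtain ⟨L, hL1, hL2⟩ := ih (by omega)
    have hC := hp i (by omega)
    obtain ⟨A, hA, B, hB, hAB, hD⟩ := hm i (by omega)
    have key : ∀ P ∈ seq (i+1), (Function.update L (A ∪ B) (L A ++ L B) P).Nodup ∧
        ∀ v, v ∈ Function.update L (A ∪ B) (L A ++ L B) P ↔ v ∈ P := by
      intro P hP
      by_cases h : P = A ∪ B
      · subst h
        rw [Function.update_self]
        refine ⟨List.Nodup.append (hL1 A hA).1 (hL1 B hB).1 ?_, ?_⟩
        · intro x hx hy
          exact hAB (puniq hC hA hB (((hL1 A hA).2 x).1 hx) (((hL1 B hB).2 x).1 hy))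
        · intro v
          rw [List.mem_append, (hL1 A hA).2, (hL1 B hB).2]; rfl
      · rw [Function.update_of_ne h]
        rw [hD] at hP
        rcases hP with hP | hP
        · exact hL1 P hP.1
        · exact (h hP).elim
    refine ⟨_, key, ?_⟩
    intro j hj Q hQ
    rcases Nat.lt_or_ge i j with hij | hij
    · obtain rfl : j = i + 1 := by omega
      exact ⟨Q, hQ, _, List.infix_rfl, (key Q hQ).2⟩
    · obtain ⟨P, hP, m, hm1, hm2⟩ := hL2 j hij Q hQ
      by_cases hPA : P = A
      · subst hPA
        refine ⟨P ∪ B, hD ▸ Or.inr rfl, m, ?_, hm2⟩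
        rw [Function.update_self]
        exact hm1.trans (List.prefix_append _ _).isInfix
      by_cases hPB : P = B
      · subst hPB
        refine ⟨A ∪ P, hD ▸ Or.inr rfl, m, ?_, hm2⟩
        rw [Function.update_self]
        exact hm1.trans (List.suffix_append _ _).isInfix
      refine ⟨P, hD ▸ Or.inl ⟨hP, by simp [hPA, hPB]⟩, m, ?_, hm2⟩
      rw [Function.update_of_ne]
      · exact hm1
      · intro h
        obtain ⟨a, ha⟩ := hC.1 A hA
        exact hPA (puniq hC hP hA (h ▸ Or.inl ha) ha)

open Classical in
theorem order_equiv [Fintype V] (l : List V) (hl : l.Nodup) (hall : ∀ v, v ∈ l) :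
    ∃ σ : V ≃ Fin (Fintype.card V), ∀ Q : Set V, (∃ m, m <:+: l ∧ ∀ v, v ∈ m ↔ v ∈ Q) →
      (σ '' Q).OrdConnected := by
  have e := hl.getEquivOfForallMemList l hall
  let e : Fin l.length ≃ V := hl.getEquivOfForallMemList l hall
  have hlen : l.length = Fintype.card V := by simpa using Fintype.card_congr e
  refine ⟨e.symm.trans (finCongr hlen), ?_⟩
  rintro Q ⟨m, ⟨s, t, rfl⟩, hmQ⟩
  have hmem : ∀ k : Fin (s ++ m ++ t).length, e k ∈ Q ↔ s.length ≤ k ∧ k < s.length + m.length := by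
    intro k
    have hek : e k = (s ++ m ++ t)[k.1] := rfl
    have hk := k.2
    constructor
    · intro h
      rw [← hmQ, List.mem_iff_getElem] at h
      obtain ⟨r, hr, hr'⟩ := h
      have : e ⟨s.length + r, by simp; omega⟩ = e k := by
        rw [← hr']
        change (s ++ m ++ t)[s.length + r]'_ = _
        simp [List.getElem_append, hr]
      have := congrArg Fin.val (e.injective this)
      simp only at this
      omega
    · rintro ⟨h1, h2⟩
      rw [← hmQ, hek]
      have : (s ++ m ++ t)[k.1] = m[k.1 - s.length]'(by omega) := by
        have h3 : k.1 - s.length < m.length := by omega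
        simp [List.getElem_append, h3, Nat.not_lt.2 h1]
      rw [this]
      exact List.getElem_mem _
  constructor
  rintro _ ⟨a, ha, rfl⟩ _ ⟨b, hb, rfl⟩ x ⟨hx1, hx2⟩
  refine ⟨e ((finCongr hlen).symm x), ?_, by simp⟩
  obtain ⟨k, rfl⟩ := e.surjective a
  obtain ⟨k', rfl⟩ := e.surjective b
  rw [hmem] at ha hb ⊢
  simp [Fin.le_def] at hx1 hx2 ⊢
  omega

end IBP

/-- Every graph on `n ≥ 1` vertices of twin-width at most `d` admits an interval
biclique partition of size at most `(d + 1) * (n - 1)`: a vertex ordering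
`σ : V ≃ Fin n` and at most `(d + 1) * (n - 1)` bicliques `(A i, B i)` whose sides
are sets of consecutive vertices (order-convex in `Fin n`), fully joined, and such
that every edge of `G` lies in exactly one biclique. -/
theorem stmt_9 {V : Type*} [Fintype V] (G : SimpleGraph V) (d : ℕ)
    (hn : 1 ≤ Fintype.card V) (htww : TwwLe G d) :
    ∃ (σ : V ≃ Fin (Fintype.card V)) (m : ℕ) (A B : Fin m → Set V),
      m ≤ (d + 1) * (Fintype.card V - 1) ∧
      (∀ i, Disjoint (A i) (B i)) ∧
      (∀ i, (σ '' A i).OrdConnected) ∧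
      (∀ i, (σ '' B i).OrdConnected) ∧
      (∀ i, ∀ a ∈ A i, ∀ b ∈ B i, G.Adj a b) ∧
      (∀ u v : V, G.Adj u v →
        ∃! i, (u ∈ A i ∧ v ∈ B i) ∨ (u ∈ B i ∧ v ∈ A i)) := by
  classical
  obtain ⟨seq, h0, hN, hm, hp⟩ := htww
  obtain ⟨L, hL1, hL2⟩ := IBP.ordering (Fintype.card V - 1) seq h0 hm (fun i hi => (hp i hi).1)
    _ le_rfl
  obtain ⟨S, hS1, hS2, -, hS4⟩ := IBP.bicliques G d (Fintype.card V - 1) seq h0 hm hp _ le_rfl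
  rw [hN] at hL1 hL2 hS4
  obtain ⟨hnd, hmem⟩ := hL1 Set.univ rfl
  obtain ⟨σ, hσ⟩ := IBP.order_equiv (L Set.univ) hnd (fun v => (hmem v).2 trivial)
  have hint : ∀ j ≤ Fintype.card V - 1, ∀ Q ∈ seq j, (σ '' Q).OrdConnected := by
    intro j hj Q hQ
    obtain ⟨P, hP, m, h⟩ := hL2 j hj Q hQ
    rw [Set.mem_singleton_iff] at hP
    subst hP
    exact hσ Q ⟨m, h⟩
  let e : S ≃ Fin S.ncard := Finite.equivFinOfCardEq rfl
  have hprop := fun i => hS2 (e.symm i).1 (e.symm i).2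
  refine ⟨σ, S.ncard, fun i => (e.symm i).1.1, fun i => (e.symm i).1.2, hS1, ?_, ?_, ?_, ?_, ?_⟩
  · exact fun i => (hprop i).2.2.1
  · intro i
    obtain ⟨j, hj, h⟩ := (hprop i).1
    exact hint j hj _ h
  · intro i
    obtain ⟨j, hj, h⟩ := (hprop i).2.1
    exact hint j hj _ h
  · exact fun i => (hprop i).2.2.2
  · intro u v huv
    obtain ⟨p, ⟨hpS, hpc⟩, hpu⟩ := hS4 u v huv (by
      rintro ⟨P, hP, Q, hQ, hne, -⟩
      exact hne (hP.trans hQ.symm))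
    refine ⟨e ⟨p, hpS⟩, ?_, ?_⟩
    · simpa [IBP.Cov] using hpc
    · intro i hi
      have := hpu (e.symm i).1 ⟨(e.symm i).2, hi⟩
      rw [← e.symm_apply_eq]
      exact Subtype.ext this
end

section
/- For every integer t there exists a constant c_t such that the following holds for every nonempty finite simple graph G of twin-width at most t. For every function w : V(G) → [0,1] satisfying, for each vertex x, the inequality Σ_{y ∈ N[x]} w(y) ≥ 1 (where N[x] is the closed neighborhood of x), the graph G has a dominating set D with |D| ≤ c_t · Σ_{x ∈ V(G)} w(x). In other words, the integrality gap of Minimum Dominating Set is bounded on classes of bounded twin-width. -/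
variable {V : Type*}

open Classical in
/-- Weight of a set of vertices. -/
noncomputable def wtSet {V : Type} [Fintype V] (w : V → ℝ) (S : Set V) : ℝ :=
  ∑ y ∈ Finset.univ.filter (fun y => y ∈ S), w y

/-- `x` is dominated by `D`. -/
def DomBy {V : Type} (G : SimpleGraph V) (D : Finset V) (x : V) : Prop :=
  x ∈ D ∨ ∃ y ∈ D, G.Adj x y

/-- A part all of whose vertices are dominated by a single vertex. -/
def GoodPart {V : Type} (G : SimpleGraph V) (P : Set V) : Prop :=
  ∃ y, ∀ x ∈ P, y = x ∨ G.Adj x y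

theorem DomBy.mono {V : Type} {G : SimpleGraph V} {D E : Finset V} {x : V}
    (h : DomBy G D x) (hs : D ⊆ E) : DomBy G E x := by
  rcases h with h | ⟨y, hy, h⟩
  · exact Or.inl (hs h)
  · exact Or.inr ⟨y, hs hy, h⟩

theorem DomBy.of_mem {V : Type} {G : SimpleGraph V} {D : Finset V} {x y : V}
    (hy : y ∈ D) (h : y = x ∨ G.Adj x y) : DomBy G D x := by
  rcases h with h | h
  · exact Or.inl (h ▸ hy)
  · exact Or.inr ⟨y, hy, h⟩

theorem GoodPart.anti {V : Type} {G : SimpleGraph V} {P Q : Set V}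
    (h : GoodPart G Q) (hs : P ⊆ Q) : GoodPart G P := by
  obtain ⟨y, hy⟩ := h
  exact ⟨y, fun x hx => hy x (hs hx)⟩

theorem wtSet_mono {V : Type} [Fintype V] {w : V → ℝ} (hw : ∀ x, 0 ≤ w x) {S T : Set V}
    (h : S ⊆ T) : wtSet w S ≤ wtSet w T := by
  classical
  unfold wtSet
  apply Finset.sum_le_sum_of_subset_of_nonneg
  · intro y hy
    simp only [Finset.mem_filter, Finset.mem_univ, true_and] at hy ⊢
    exact h hy
  · intros; exact hw _

theorem wtSet_union_disj {V : Type} [Fintype V] {w : V → ℝ} {S T : Set V}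
    (h : Disjoint S T) : wtSet w (S ∪ T) = wtSet w S + wtSet w T := by
  classical
  unfold wtSet
  rw [← Finset.sum_union]
  · congr 1; ext y; simp
  · rw [Finset.disjoint_left]
    intro y hy hy2
    simp only [Finset.mem_filter, Finset.mem_univ, true_and] at hy hy2
    exact Set.disjoint_left.mp h hy hy2

theorem wtSet_union_le {V : Type} [Fintype V] {w : V → ℝ} (hw : ∀ x, 0 ≤ w x) (S T : Set V) :
    wtSet w (S ∪ T) ≤ wtSet w S + wtSet w T := by
  rw [← Set.union_sdiff_self, wtSet_union_disj Set.disjoint_sdiff_right]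
  have := wtSet_mono hw (Set.sdiff_subset : T \ S ⊆ T)
  linarith

theorem wtSet_le_sum {V : Type} [Fintype V] {w : V → ℝ} (hw : ∀ x, 0 ≤ w x)
    (F : Finset (Set V)) (g : Set V → Set V) : ∀ (S : Set V), (∀ y ∈ S, ∃ Q ∈ F, y ∈ g Q) →
    wtSet w S ≤ ∑ Q ∈ F, wtSet w (g Q) := by
  classical
  induction F using Finset.induction_on with
  | empty =>
    intro S h
    have : S = ∅ := by
      ext y; constructor
      · intro hy; obtain ⟨Q, hQ, _⟩ := h y hy; simp at hQ
      · intro hy; exact hy.elim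
    subst this
    simp [wtSet]
  | insert a F ha ih =>
    intro S h
    rw [Finset.sum_insert ha]
    have h1 : wtSet w (S \ g a) ≤ ∑ Q ∈ F, wtSet w (g Q) := by
      apply ih
      intro y hy
      obtain ⟨Q, hQ, hyQ⟩ := h y hy.1
      rcases Finset.mem_insert.mp hQ with rfl | hQ
      · exact (hy.2 hyQ).elim
      · exact ⟨Q, hQ, hyQ⟩
    have h2 : wtSet w S ≤ wtSet w (g a ∪ (S \ g a)) := by
      apply wtSet_mono hw
      intro y hy
      by_cases hya : y ∈ g a
      · exact Or.inl hya
      · exact Or.inr ⟨hy, hya⟩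
    have h3 := wtSet_union_le hw (g a) (S \ g a)
    linarith

/-- The invariant maintained along the contraction sequence. -/
structure GapInv {V : Type} [Fintype V] (G : SimpleGraph V) (w : V → ℝ) (t : ℕ) (ε : ℝ)
    (C : Set (Set V)) (D : Finset V) (K : Set V) : Prop where
  size : (D.card : ℝ) * ε ≤ (t + 2) * wtSet w K
  light : ∀ P ∈ C, wtSet w (P \ K) < ε
  good : ∀ P ∈ C, GoodPart G P → ∀ x ∈ P, ∀ y ∈ K, (y = x ∨ G.Adj x y) → DomBy G D x
  bad : ∀ P ∈ C, ¬ GoodPart G P → ∀ x ∈ P, DomBy G D x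

theorem gapInv_init {V : Type} [Fintype V] (G : SimpleGraph V) (w : V → ℝ) (t : ℕ) (ε : ℝ)
    (hε : 0 < ε) (hw : ∀ x, 0 ≤ w x) :
    ∃ D K, GapInv G w t ε (Set.range (fun v : V => ({v} : Set V))) D K := by
  classical
  refine ⟨Finset.univ.filter (fun v => ε ≤ w v), {v | ε ≤ w v}, ?_, ?_, ?_, ?_⟩
  · have h1 : ((Finset.univ.filter (fun v => ε ≤ w v)).card : ℝ) * ε ≤
        wtSet w {v | ε ≤ w v} := by
      unfold wtSet
      rw [← nsmul_eq_mul]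
      simp only [Set.mem_ofPred_eq]
      apply Finset.card_nsmul_le_sum
      intro x hx
      simpa using hx
    have h2 : 0 ≤ wtSet w {v | ε ≤ w v} := Finset.sum_nonneg (fun x _ => hw x)
    have h3 : (0 : ℝ) ≤ t := Nat.cast_nonneg t
    nlinarith
  · rintro P ⟨v, rfl⟩
    by_cases h : ε ≤ w v
    · have : ({v} : Set V) \ {v | ε ≤ w v} = ∅ := by
        ext y; simp only [Set.mem_sdiff, Set.mem_singleton_iff, Set.mem_ofPred_eq,
          Set.mem_empty_iff_false, iff_false]
        rintro ⟨rfl, h2⟩; exact h2 h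
      simp only [this]
      simpa [wtSet] using hε
    · have h1 : wtSet w (({v} : Set V) \ {v | ε ≤ w v}) ≤ wtSet w {v} :=
        wtSet_mono hw Set.sdiff_subset
      have h2 : wtSet w {v} = w v := by
        rw [wtSet, Finset.sum_filter]
        simp
      simp only [not_le] at h
      linarith
  · intro P _ _ x _ y hy hxy
    exact DomBy.of_mem (by simpa using hy) hxy
  · rintro P ⟨v, rfl⟩ hb
    exact (hb ⟨v, fun x hx => Or.inl hx.symm⟩).elim

theorem gapInv_step {V : Type} [Fintype V] [DecidableEq V] (G : SimpleGraph V)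
    [DecidableRel G.Adj] (w : V → ℝ) (t : ℕ)
    (ε : ℝ) (hε : 0 < ε) (hεt : 2 * ε * (t + 1) = 1) (hw : ∀ x, 0 ≤ w x)
    (hdom : ∀ x : V, 1 ≤ ∑ y ∈ Finset.univ.filter (fun y => y = x ∨ G.Adj x y), w y)
    (C C' : Set (Set V)) (hm : MergeStep C C') (hC' : IsVPartition C')
    (hred : ∀ P ∈ C', G.redDegree C' P ≤ t)
    (D : Finset V) (K : Set V) (hI : GapInv G w t ε C D K) :
    ∃ D' K', GapInv G w t ε C' D' K' := by
  classical
  obtain ⟨A, hA, B, hB, hAB, hCC⟩ := hm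
  have hR : A ∪ B ∈ C' := by rw [hCC]; exact Or.inr rfl
  have hold : ∀ P ∈ C', P ≠ A ∪ B → P ∈ C := by
    intro P hP hne
    rw [hCC] at hP
    rcases hP with hP | hP
    · exact hP.1
    · exact (hne hP).elim
  have hsub : ∀ P ∈ C', ∀ x ∈ P, ∃ P0 ∈ C, x ∈ P0 ∧ P0 ⊆ P := by
    intro P hP x hx
    by_cases hne : P = A ∪ B
    · subst hne
      rcases hx with hx | hx
      · exact ⟨A, hA, hx, Set.subset_union_left⟩
      · exact ⟨B, hB, hx, Set.subset_union_right⟩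
    · exact ⟨P, hold P hP hne, hx, subset_rfl⟩
  set R := A ∪ B with hRdef
  -- parts equal or red to R
  let S : Finset (Set V) :=
    (Set.toFinite (insert R {Q | Q ∈ C' ∧ Q ≠ R ∧ ¬ G.Homog R Q})).toFinset
  have hScard : S.card ≤ t + 1 := by
    rw [← Set.ncard_eq_toFinset_card]
    refine (Set.ncard_insert_le _ _).trans ?_
    have := hred R hR
    unfold SimpleGraph.redDegree at this
    omega
  have hSmem : ∀ Q, Q ∈ S ↔ (Q = R ∨ (Q ∈ C' ∧ Q ≠ R ∧ ¬ G.Homog R Q)) := by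
    intro Q
    simp [S]
    tauto
  have hlight2 : ∀ Q ∈ C', wtSet w (Q \ K) < 2 * ε := by
    intro Q hQ
    by_cases hne : Q = R
    · have h1 := hI.light A hA
      have h2 := hI.light B hB
      rw [hne, hRdef, Set.union_sdiff_distrib]
      have := wtSet_union_le hw (A \ K) (B \ K)
      linarith
    · have := hI.light Q (hold Q hQ hne)
      linarith
  have hbad : ∀ P ∈ C', ¬ GoodPart G P → ∀ x ∈ P, DomBy G D x := by
    intro P hP hb x hx
    obtain ⟨P0, hP0, hx0, hP0P⟩ := hsub P hP x hx
    by_cases hg0 : GoodPart G P0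
    swap
    · exact hI.bad P0 hP0 hg0 x hx0
    by_cases hne : P = R
    swap
    · exact hI.bad P (hold P hP hne) hb x hx
    subst hne
    by_contra hnd
    have hnK : ∀ y, (y = x ∨ G.Adj x y) → y ∉ K := fun y hy hyK =>
      hnd (hI.good P0 hP0 hg0 x hx0 y hyK hy)
    have h1 : wtSet w {y | y = x ∨ G.Adj x y} ≤ ∑ Q ∈ S, wtSet w (Q \ K) := by
      apply wtSet_le_sum hw S (fun Q => Q \ K)
      intro y hy
      obtain ⟨Q, ⟨hQ, hyQ⟩, _⟩ := hC'.2 y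
      refine ⟨Q, ?_, hyQ, hnK y hy⟩
      rw [hSmem]
      by_cases hQR : Q = R
      · exact Or.inl hQR
      refine Or.inr ⟨hQ, hQR, ?_⟩
      rintro (hh | hh)
      · exact hb ⟨y, fun z hz => Or.inr (hh z hz y hyQ)⟩
      · rcases hy with hy | hy
        · subst hy
          exact hQR ((hC'.2 y).unique ⟨hQ, hyQ⟩ ⟨hR, hx⟩)
        · exact hh x hx y hyQ hy
    have h2 : 1 ≤ wtSet w {y | y = x ∨ G.Adj x y} := by
      refine (hdom x).trans (le_of_eq ?_)
      unfold wtSet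
      congr 1
      ext y
      simp
    have h3 : ∑ Q ∈ S, wtSet w (Q \ K) < ∑ Q ∈ S, 2 * ε := by
      apply Finset.sum_lt_sum_of_nonempty
      · exact ⟨R, (hSmem R).2 (Or.inl rfl)⟩
      · intro Q hQ
        rcases (hSmem Q).1 hQ with h | h
        · exact hlight2 Q (h ▸ hR)
        · exact hlight2 Q h.1
    rw [Finset.sum_const, nsmul_eq_mul] at h3
    have h4 : (S.card : ℝ) ≤ t + 1 := by exact_mod_cast hScard
    nlinarith
  have hgood : ∀ P ∈ C', GoodPart G P → ∀ x ∈ P, ∀ y ∈ K, (y = x ∨ G.Adj x y) →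
      DomBy G D x := by
    intro P hP hg x hx y hy hxy
    obtain ⟨P0, hP0, hx0, hP0P⟩ := hsub P hP x hx
    exact hI.good P0 hP0 (hg.anti hP0P) x hx0 y hy hxy
  by_cases hev : wtSet w (R \ K) < ε
  · refine ⟨D, K, hI.size, ?_, hgood, hbad⟩
    intro P hP
    by_cases hne : P = R
    · rw [hne]; exact hev
    · exact hI.light P (hold P hP hne)
  -- event: R becomes covered
  rw [not_lt] at hev
  obtain ⟨r, hr⟩ := hC'.1 R hR
  let f : Set V → V := fun P => if h : GoodPart G P then h.choose else r
  have hf : ∀ P, GoodPart G P → ∀ x ∈ P, f P = x ∨ G.Adj x (f P) := by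
    intro P h
    simp only [f, dif_pos h]
    exact h.choose_spec
  have hDs : D ⊆ D ∪ ({r} ∪ S.image f) := Finset.subset_union_left
  refine ⟨D ∪ ({r} ∪ S.image f), K ∪ R, ?_, ?_, ?_, ?_⟩
  · have h1 : (D ∪ ({r} ∪ S.image f)).card ≤ D.card + (1 + (t + 1)) := by
      refine (Finset.card_union_le _ _).trans (Nat.add_le_add_left ?_ _)
      refine (Finset.card_union_le _ _).trans ?_
      have := (Finset.card_image_le : (S.image f).card ≤ S.card)
      simp only [Finset.card_singleton]
      omega
    have h2 : ((D ∪ ({r} ∪ S.image f)).card : ℝ) ≤ D.card + (t + 2) := by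
      have : ((D ∪ ({r} ∪ S.image f)).card : ℝ) ≤ ((D.card + (1 + (t + 1)) : ℕ) : ℝ) := by
        exact_mod_cast h1
      push_cast at this
      linarith
    have h3 : wtSet w (K ∪ R) = wtSet w K + wtSet w (R \ K) := by
      rw [← Set.union_sdiff_self, wtSet_union_disj Set.disjoint_sdiff_right]
    have h4 := hI.size
    rw [h3]
    have h5 := mul_le_mul_of_nonneg_right h2 hε.le
    have h6 : ((t : ℝ) + 2) * ε ≤ (t + 2) * wtSet w (R \ K) :=
      mul_le_mul_of_nonneg_left hev (by positivity)
    nlinarith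
  · intro P hP
    by_cases hne : P = R
    · have : R \ (K ∪ R) = ∅ := by
        ext y; simp; tauto
      rw [hne, this]
      simpa [wtSet] using hε
    · refine lt_of_le_of_lt (wtSet_mono hw ?_) (hI.light P (hold P hP hne))
      exact Set.sdiff_subset_sdiff_right Set.subset_union_left
  · intro P hP hg x hx y hy hxy
    rcases hy with hy | hy
    · exact (hgood P hP hg x hx y hy hxy).mono hDs
    by_cases hPS : P ∈ S
    · apply DomBy.of_mem (y := f P) _ (hf P hg x hx)
      simp only [Finset.mem_union, Finset.mem_image]
      exact Or.inr (Or.inr ⟨P, hPS, rfl⟩)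
    · rw [hSmem] at hPS
      push Not at hPS
      obtain ⟨hne, hh⟩ := hPS
      have hadj : G.Adj x y := by
        rcases hxy with h | h
        · subst h
          exact (hne ((hC'.2 y).unique ⟨hP, hx⟩ ⟨hR, hy⟩)).elim
        · exact h
      rcases hh hP hne with hh | hh
      · apply DomBy.of_mem (y := r) _ (Or.inr (hh r hr x hx).symm)
        simp
      · exact (hh y hy x hx hadj.symm).elim
  · intro P hP hb x hx
    exact (hbad P hP hb x hx).mono hDs

/-- Bounded integrality gap of Minimum Dominating Set on bounded twin-width classes:
for every `t` there is a constant `c` such that every nonempty graph of twin-width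
at most `t` has, for every fractional dominating set `w`, a dominating set of size
at most `c` times the total weight of `w`. -/
theorem stmt_13 : ∀ t : ℕ, ∃ c : ℕ,
    ∀ (V : Type) [Fintype V] [Nonempty V] [DecidableEq V]
      (G : SimpleGraph V) [DecidableRel G.Adj],
      TwwLe G t →
      ∀ w : V → ℝ, (∀ x : V, 0 ≤ w x ∧ w x ≤ 1) →
        (∀ x : V, 1 ≤ ∑ y ∈ Finset.univ.filter (fun y => y = x ∨ G.Adj x y), w y) →
        ∃ D : Finset V, (∀ x : V, x ∈ D ∨ ∃ y ∈ D, G.Adj x y) ∧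
          (D.card : ℝ) ≤ (c : ℝ) * ∑ x : V, w x := by
  intro t
  refine ⟨2 * (t + 1) * (t + 2) + 1, ?_⟩
  intro V _ _ _ G _ htw w hw hdom
  classical
  obtain ⟨seq, h0, hlast, hstep, hpart⟩ := htw
  have hw0 : ∀ x, 0 ≤ w x := fun x => (hw x).1
  have htp : (0 : ℝ) < t + 1 := by positivity
  obtain ⟨ε, hεt⟩ : ∃ ε : ℝ, 2 * ε * (t + 1) = 1 := ⟨1 / (2 * (t + 1)), by field_simp⟩
  have hε : 0 < ε := by
    by_contra h
    push Not at h
    nlinarith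
  have hinv : ∀ i ≤ Fintype.card V - 1, ∃ D K, GapInv G w t ε (seq i) D K := by
    intro i
    induction i with
    | zero => intro _; rw [h0]; exact gapInv_init G w t ε hε hw0
    | succ i ih =>
      intro hi
      obtain ⟨D, K, hI⟩ := ih (by omega)
      exact gapInv_step G w t ε hε hεt hw0 hdom _ _ (hstep i (by omega)) (hpart _ hi).1
        (hpart _ hi).2 D K hI
  obtain ⟨D, K, hI⟩ := hinv _ le_rfl
  rw [hlast] at hI
  have hK : wtSet w K ≤ ∑ x : V, w x := by
    unfold wtSet
    exact Finset.sum_le_sum_of_subset_of_nonneg (Finset.filter_subset _ _)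
      (fun x _ _ => hw0 x)
  have hW1 : 1 ≤ ∑ x : V, w x := by
    obtain ⟨x⟩ := ‹Nonempty V›
    refine (hdom x).trans ?_
    exact Finset.sum_le_sum_of_subset_of_nonneg (Finset.filter_subset _ _)
      (fun x _ _ => hw0 x)
  have hcard : (D.card : ℝ) ≤ 2 * (t + 1) * (t + 2) * ∑ x : V, w x := by
    have h1 : (D.card : ℝ) * ε ≤ (t + 2) * ∑ x : V, w x :=
      hI.size.trans (mul_le_mul_of_nonneg_left hK (by positivity))
    have h2 := mul_le_mul_of_nonneg_left h1 (by positivity : (0 : ℝ) ≤ 2 * (t + 1))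
    have h3 : 2 * ((t : ℝ) + 1) * (D.card * ε) = D.card := by
      linear_combination (D.card : ℝ) * hεt
    rw [h3] at h2
    linarith
  by_cases hg : GoodPart G (Set.univ : Set V)
  · obtain ⟨y, hy⟩ := hg
    refine ⟨{y}, fun x => DomBy.of_mem (Finset.mem_singleton_self y) (hy x trivial), ?_⟩
    push_cast
    have : (0 : ℝ) ≤ 2 * (t + 1) * (t + 2) * ∑ x : V, w x :=
      (Nat.cast_nonneg _).trans hcard
    simp only [Finset.card_singleton, Nat.cast_one]
    linarith
  · refine ⟨D, fun x => hI.bad _ rfl hg x trivial, ?_⟩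
    push_cast
    linarith
end

section
/- For every integer t there exists a constant c_t such that the following holds for every nonempty finite simple graph G of twin-width at most t. For every function w : V(G) → [0,1] satisfying, for each vertex x, the inequality Σ_{y ∈ N[x]} w(y) ≤ 1 (where N[x] is the closed neighborhood of x), the graph G contains a 2-independent set S (a set of vertices pairwise at distance greater than 2 in G) with |S| ≥ (Σ_{x ∈ V(G)} w(x)) / c_t. In other words, the integrality gap of Maximum 2-Independent Set is bounded on classes of bounded twin-width. -/
variable {V : Type*}

section Helpers

open Classical in
/-- Weight of a vertex set. -/
noncomputable def wt14 {V : Type} [Fintype V] (w : V → ℝ) (P : Set V) : ℝ :=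
  ∑ x, if x ∈ P then w x else 0

lemma wt14_mono {V : Type} [Fintype V] {w : V → ℝ} (hw : ∀ x, 0 ≤ w x) {P Q : Set V}
    (h : P ⊆ Q) : wt14 w P ≤ wt14 w Q := by
  unfold wt14
  apply Finset.sum_le_sum
  intro x _
  have := hw x
  by_cases h1 : x ∈ P
  · simp [h1, h h1]
  · by_cases h2 : x ∈ Q <;> simp [h1, h2, this]

lemma wt14_union {V : Type} [Fintype V] {w : V → ℝ} (hw : ∀ x, 0 ≤ w x) (P Q : Set V) :
    wt14 w (P ∪ Q) ≤ wt14 w P + wt14 w Q := by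
  unfold wt14
  rw [← Finset.sum_add_distrib]
  apply Finset.sum_le_sum
  intro x _
  have := hw x
  by_cases h1 : x ∈ P <;> by_cases h2 : x ∈ Q <;> simp [h1, h2, this]

lemma wt14_biUnion {V : Type} [Fintype V] {w : V → ℝ} (hw : ∀ x, 0 ≤ w x)
    (f : Set V → Set V) (K : ℝ) (F : Set (Set V)) (hF : ∀ P ∈ F, wt14 w (f P) ≤ K) :
    wt14 w (⋃ P ∈ F, f P) ≤ F.ncard * K := by
  have hfin : F.Finite := Set.toFinite F
  induction F, hfin using Set.Finite.induction_on with
  | empty => simp [wt14]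
  | @insert a s ha hs ih =>
    rw [Set.ncard_insert_of_notMem ha hs, Set.biUnion_insert]
    have h1 := wt14_union hw (f a) (⋃ P ∈ s, f P)
    have h2 := ih (fun P hP => hF P (Set.mem_insert_of_mem _ hP))
    have h3 := hF a (Set.mem_insert _ _)
    push_cast
    linarith

/-- The ball of radius two. -/
def ball14 {V : Type} (G : SimpleGraph V) (x : V) : Set V :=
  {y | y = x ∨ G.Adj x y ∨ ∃ z, G.Adj x z ∧ G.Adj z y}

/-- Some vertex of positive weight has a radius-two ball of bounded weight. -/
lemma claim14 {V : Type} [Fintype V] (G : SimpleGraph V) (t : ℕ)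
    (hG : TwwLe G t) (w : V → ℝ) (hw : ∀ x, 0 ≤ w x)
    (hN : ∀ x, wt14 w {y | y = x ∨ G.Adj x y} ≤ 1) (hpos : ∃ x, 0 < w x) :
    ∃ x, 0 < w x ∧ wt14 w (ball14 G x) ≤ 2 + t * (3 + t * 2) := by
  classical
  have ht : (0 : ℝ) ≤ t := Nat.cast_nonneg t
  by_cases hW : wt14 w Set.univ ≤ 1
  · obtain ⟨x, hx⟩ := hpos
    refine ⟨x, hx, ?_⟩
    have := wt14_mono hw (Set.subset_univ (ball14 G x))
    nlinarith [mul_nonneg ht ht]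
  push Not at hW
  obtain ⟨seq, h0, hlast, hstep, hpart⟩ := hG
  have hex : ∃ i, i ≤ Fintype.card V - 1 ∧ ∃ P ∈ seq i, 1 < wt14 w P :=
    ⟨_, le_rfl, Set.univ, by rw [hlast]; rfl, hW⟩
  obtain ⟨hi, P, hP, hP1⟩ := Nat.find_spec hex
  have hmin := fun j => Nat.find_min (m := j) hex
  generalize Nat.find hex = i at hi P hP hP1 hmin
  have hle2 : ∀ Q ∈ seq i, wt14 w Q ≤ 2 := by
    intro Q hQ
    cases i with
    | zero =>
      rw [h0] at hQ
      obtain ⟨v, rfl⟩ := hQ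
      have := wt14_mono hw (P := {v}) (Q := {y | y = v ∨ G.Adj v y})
        (by rintro y rfl; exact Or.inl rfl)
      linarith [hN v]
    | succ j =>
      have hj : ∀ Q ∈ seq j, wt14 w Q ≤ 1 := by
        intro Q hQ
        by_contra hc
        exact hmin j (Nat.lt_succ_self j) ⟨by omega, Q, hQ, not_le.mp hc⟩
      obtain ⟨A, hA, B, hB, _, hD⟩ := hstep j (by omega)
      rw [hD] at hQ
      rcases hQ with hQ | hQ
      · linarith [hj Q hQ.1]
      · rw [Set.mem_singleton_iff.mp hQ]
        linarith [hj A hA, hj B hB, wt14_union hw A B]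
  obtain ⟨⟨hne, hcov⟩, hred⟩ := hpart i hi
  -- red neighbours
  let red : Set V → Set (Set V) := fun P => {Q | Q ∈ seq i ∧ Q ≠ P ∧ ¬ G.Homog P Q}
  have hredcard : ∀ Q ∈ seq i, ((red Q).ncard : ℝ) ≤ t := by
    intro Q hQ
    exact_mod_cast hred Q hQ
  have hrep : ∀ Q : Set V, ∃ q, Q ∈ seq i → q ∈ Q := by
    intro Q
    by_cases hQ : Q ∈ seq i
    · exact ⟨(hne Q hQ).some, fun _ => (hne Q hQ).some_mem⟩
    · exact ⟨hpos.choose, fun h => absurd h hQ⟩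
  choose rep hrep using hrep
  let f : Set V → Set V := fun Q => (Q ∪ {y | y = rep Q ∨ G.Adj (rep Q) y}) ∪ ⋃ R ∈ red Q, R
  have hf : ∀ Q ∈ red P, wt14 w (f Q) ≤ 3 + t * 2 := by
    intro Q hQ
    have h1 := wt14_union hw (Q ∪ {y | y = rep Q ∨ G.Adj (rep Q) y}) (⋃ R ∈ red Q, R)
    have h2 := wt14_union hw Q {y | y = rep Q ∨ G.Adj (rep Q) y}
    have h3 := wt14_biUnion hw (fun R => R) 2 (red Q) (fun R hR => hle2 R hR.1)
    have h4 := hredcard Q hQ.1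
    have h5 := hle2 Q hQ.1
    have h6 := hN (rep Q)
    change wt14 w ((Q ∪ {y | y = rep Q ∨ G.Adj (rep Q) y}) ∪ ⋃ R ∈ red Q, R) ≤ _
    linarith
  -- neighbours of `P`
  have hnb : ∀ x ∈ P, ∀ z, G.Adj x z → z ∈ P ∨ ∃ Q ∈ red P, z ∈ Q := by
    intro x hx z hxz
    obtain ⟨Q, ⟨hQ, hzQ⟩, _⟩ := hcov z
    by_cases hQP : Q = P
    · left; rwa [← hQP]
    · right
      refine ⟨Q, ⟨hQ, hQP, ?_⟩, hzQ⟩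
      rintro (h | h)
      · have := wt14_mono hw (P := P) (Q := {y | y = z ∨ G.Adj z y})
          (fun y hy => Or.inr (h y hy z hzQ).symm)
        linarith [hN z]
      · exact h x hx z hzQ hxz
  have hxP : ∃ x ∈ P, 0 < w x := by
    by_contra hc
    push Not at hc
    have : wt14 w P ≤ 0 := by
      unfold wt14
      apply Finset.sum_nonpos
      intro x _
      split_ifs with h
      · exact hc x h
      · exact le_rfl
    linarith
  obtain ⟨x, hx, hwx⟩ := hxP
  refine ⟨x, hwx, ?_⟩
  have hsub : ball14 G x ⊆ P ∪ ⋃ Q ∈ red P, f Q := by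
    have key : ∀ y, (y ∈ P ∨ ∃ Q ∈ red P, y ∈ Q) → y ∈ P ∪ ⋃ Q ∈ red P, f Q := by
      rintro y (h | ⟨Q, hQ, h⟩)
      · exact Or.inl h
      · exact Or.inr (Set.mem_biUnion hQ (Or.inl (Or.inl h)))
    rintro y (rfl | h | ⟨z, hxz, hzy⟩)
    · exact Or.inl hx
    · exact key y (hnb x hx y h)
    · rcases hnb x hx z hxz with hz | ⟨Q, hQ, hz⟩
      · exact key y (hnb z hz y hzy)
      · refine Or.inr (Set.mem_biUnion hQ ?_)
        obtain ⟨R, ⟨hR, hyR⟩, _⟩ := hcov y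
        by_cases hRQ : R = Q
        · exact Or.inl (Or.inl (hRQ ▸ hyR))
        by_cases hh : G.Homog Q R
        · rcases hh with h | h
          · exact Or.inl (Or.inr (Or.inr (h _ (hrep Q hQ.1) y hyR)))
          · exact absurd hzy (h z hz y hyR)
        · exact Or.inr (Set.mem_biUnion (show R ∈ red Q from ⟨hR, hRQ, hh⟩) hyR)
  have h1 := wt14_mono hw hsub
  have h2 := wt14_union hw P (⋃ Q ∈ red P, f Q)
  have h3 := wt14_biUnion hw f _ (red P) hf
  have h4 := mul_le_mul_of_nonneg_right (hredcard P hP) (show (0 : ℝ) ≤ 3 + t * 2 by positivity)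
  linarith [hle2 P hP]

lemma greedy14 {V : Type} [Fintype V] (G : SimpleGraph V) (t : ℕ)
    (hG : TwwLe G t) (w : V → ℝ) (hw : ∀ x, 0 ≤ w x)
    (hN : ∀ x, wt14 w {y | y = x ∨ G.Adj x y} ≤ 1) (U : Finset V) :
    ∃ S ⊆ U, (∀ x ∈ S, ∀ y ∈ S, x ≠ y →
            ¬ G.Adj x y ∧ ¬ ∃ z : V, G.Adj x z ∧ G.Adj z y) ∧
      ∑ x ∈ U, w x ≤ (2 + t * (3 + t * 2)) * (S.card : ℝ) := by
  classical
  induction U using Finset.strongInduction with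
  | H U ih =>
  by_cases hpos : ∃ x ∈ U, 0 < w x
  · let w' : V → ℝ := fun x => if x ∈ U then w x else 0
    have hw' : ∀ x, 0 ≤ w' x := fun x => by
      have := hw x
      simp only [w']; split_ifs <;> simp [this]
    have hle : ∀ P, wt14 w' P ≤ wt14 w P := by
      intro P
      unfold wt14
      apply Finset.sum_le_sum
      intro x _
      have := hw x
      by_cases h1 : x ∈ P <;> by_cases h2 : x ∈ U <;> simp [w', h1, h2, this]
    obtain ⟨x, hx, hball⟩ := claim14 G t hG w' hw' (fun x => (hle _).trans (hN x))
      (by obtain ⟨x, hx, h⟩ := hpos; exact ⟨x, by simpa [w', hx] using h⟩)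
    have hxU : x ∈ U := by
      by_contra h
      simp [w', h] at hx
    have hss : U.filter (fun y => y ∉ ball14 G x) ⊂ U := by
      refine Finset.filter_ssubset.mpr ⟨x, hxU, ?_⟩
      simp [ball14]
    obtain ⟨S, hSU, hS, hc⟩ := ih _ hss
    have hfar : ∀ y ∈ S, y ∉ ball14 G x := fun y hy => (Finset.mem_filter.mp (hSU hy)).2
    have hxS : x ∉ S := fun h => hfar x h (Or.inl rfl)
    refine ⟨insert x S, ?_, ?_, ?_⟩
    · exact Finset.insert_subset hxU (hSU.trans (Finset.filter_subset _ _))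
    · have hd : ∀ y ∈ S, ¬ G.Adj x y ∧ ¬ ∃ z : V, G.Adj x z ∧ G.Adj z y := fun y hy =>
        ⟨fun h => hfar y hy (Or.inr (Or.inl h)), fun h => hfar y hy (Or.inr (Or.inr h))⟩
      intro a ha b hb hab
      rcases Finset.mem_insert.mp ha with rfl | ha' <;>
        rcases Finset.mem_insert.mp hb with rfl | hb'
      · exact absurd rfl hab
      · exact hd b hb'
      · refine ⟨fun h => (hd a ha').1 h.symm, ?_⟩
        rintro ⟨z, h1, h2⟩
        exact (hd a ha').2 ⟨z, h2.symm, h1.symm⟩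
      · exact hS a ha' b hb' hab
    · rw [Finset.card_insert_of_notMem hxS]
      have h1 := Finset.sum_filter_add_sum_filter_not U (fun y => y ∈ ball14 G x) w
      have h2 : ∑ y ∈ U.filter (fun y => y ∈ ball14 G x), w y = wt14 w' (ball14 G x) := by
        unfold wt14
        rw [Finset.sum_filter, ← Finset.sum_subset (Finset.subset_univ U)]
        · apply Finset.sum_congr rfl
          intro y hy
          by_cases h : y ∈ ball14 G x <;> simp [w', h, hy]
        · intro y _ hy
          simp [w', hy]
      push_cast
      linarith
  · push Not at hpos
    exact ⟨∅, by simp, by simp, by simpa using Finset.sum_nonpos hpos⟩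

end Helpers

/-- Bounded integrality gap of Maximum 2-Independent Set on bounded twin-width
classes: for every `t` there is a constant `c > 0` such that every nonempty graph
of twin-width at most `t` has, for every fractional 2-independent set `w`, a
2-independent set (vertices pairwise at distance greater than 2) of size at least
the total weight of `w` divided by `c`. -/
theorem stmt_14 : ∀ t : ℕ, ∃ c : ℝ, 0 < c ∧
    ∀ (V : Type) [Fintype V] [Nonempty V] [DecidableEq V]
      (G : SimpleGraph V) [DecidableRel G.Adj],
      TwwLe G t →
      ∀ w : V → ℝ, (∀ x : V, 0 ≤ w x ∧ w x ≤ 1) →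
        (∀ x : V, ∑ y ∈ Finset.univ.filter (fun y => y = x ∨ G.Adj x y), w y ≤ 1) →
        ∃ S : Finset V,
          (∀ x ∈ S, ∀ y ∈ S, x ≠ y →
            ¬ G.Adj x y ∧ ¬ ∃ z : V, G.Adj x z ∧ G.Adj z y) ∧
          (∑ x : V, w x) / c ≤ (S.card : ℝ) := by
  intro t
  refine ⟨2 + t * (3 + t * 2), by positivity, ?_⟩
  intro V _ _ _ G _ hG w hw hN
  obtain ⟨S, _, hS, hc⟩ := greedy14 G t hG w (fun x => (hw x).1) (fun x => by
    have := hN x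
    rw [Finset.sum_filter] at this
    unfold wt14
    convert this using 2
    simp only [Set.mem_setOf_eq]) Finset.univ
  refine ⟨S, hS, ?_⟩
  rw [div_le_iff₀ (by positivity)]
  linarith
end
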